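/- If (W,S) is a Coxeter system in which m(s,t) ∈ {2} ∪ 4ℕ for all distinct s,t ∈ S (a strong even Coxeter system), then W is rigid: for any other generating set S' of W making (W,S') a Coxeter system, there is a bijection ψ: S → S' with m(s,t) = m'(ψ(s),ψ(t)) for all s,t ∈ S. -/

import Mathlib

open Subgroup

/-- `S` is a Coxeter generating set for the group `W`: there is a Coxeter matrix on `S` and a
Coxeter system on `W` whose simple reflections are exactly the elements of `S`. -/
def IsCoxGenSet {W : Type*} [Group W] (S : Set W) : Prop :=
  S.Finite ∧ ∃ (M : CoxeterMatrix S) (cs : CoxeterSystem M W), ∀ s : S, cs.simple s = (s : W)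

/-- `T` is a spherical subset of the generating set `S`: the parabolic subgroup `W_T` is finite. -/
def IsSpherical {W : Type*} [Group W] (S T : Set W) : Prop :=
  T ⊆ S ∧ ((Subgroup.closure T : Subgroup W) : Set W).Finite

/-- `T` is a maximal spherical subset of `S`. -/
def IsMaxSpherical {W : Type*} [Group W] (S T : Set W) : Prop :=
  IsSpherical S T ∧ ∀ U : Set W, IsSpherical S U → T ⊆ U → U = T

/-- `T` is independent: all pairwise orders `m(s,t)` equal `2`. -/
def IsIndep {W : Type*} [Group W] (T : Set W) : Prop :=
  ∀ s ∈ T, ∀ t ∈ T, s ≠ t → orderOf (s * t) = 2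

/-- `T` is a maximal independent subset of `Sb`. -/
def IsMaxIndep {W : Type*} [Group W] (Sb T : Set W) : Prop :=
  IsIndep T ∧ T ⊆ Sb ∧ ∀ U : Set W, IsIndep U → U ⊆ Sb → T ⊆ U → U = T

/-- all pairwise orders lie in `{2} ∪ 4ℕ` (with `orderOf = 0` meaning `∞`). -/
def IsStrongEvenSet {W : Type*} [Group W] (T : Set W) : Prop :=
  ∀ s ∈ T, ∀ t ∈ T, s ≠ t → (orderOf (s * t) = 2 ∨ 4 ∣ orderOf (s * t))

/-- all pairwise orders are even (with `orderOf = 0` meaning `∞`). -/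
def IsEvenSet {W : Type*} [Group W] (T : Set W) : Prop :=
  ∀ s ∈ T, ∀ t ∈ T, s ≠ t → Even (orderOf (s * t))

/-- `S̄`: the union of all maximal spherical subsets `T` of `S` with `(W_T, T)` strong even. -/
def Sbar {W : Type*} [Group W] (S : Set W) : Set W :=
  ⋃₀ {T | IsMaxSpherical S T ∧ IsStrongEvenSet T}

/-- Condition (0): even orders lie in `{2} ∪ 4ℕ`. -/
def Cond0 {W : Type*} [Group W] (S : Set W) : Prop :=
  ∀ s ∈ S, ∀ t ∈ S, s ≠ t → Even (orderOf (s * t)) →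
    (orderOf (s * t) = 2 ∨ 4 ∣ orderOf (s * t))

/-- Condition (1): odd-order pairs are maximal spherical subsets. -/
def Cond1 {W : Type*} [Group W] (S : Set W) : Prop :=
  ∀ s ∈ S, ∀ t ∈ S, s ≠ t → Odd (orderOf (s * t)) → IsMaxSpherical S {s, t}

/-- Condition (2): no three-element subset `{s,t,u}` with `m(s,t)`, `m(t,u)` both odd. -/
def Cond2 {W : Type*} [Group W] (S : Set W) : Prop :=
  ¬ ∃ s ∈ S, ∃ t ∈ S, ∃ u ∈ S, s ≠ t ∧ t ≠ u ∧ s ≠ u ∧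
    Odd (orderOf (s * t)) ∧ Odd (orderOf (t * u))

/-- Condition (3): each odd pair meets at most two maximal spherical subsets. -/
def Cond3 {W : Type*} [Group W] (S : Set W) : Prop :=
  ∀ s ∈ S, ∀ t ∈ S, s ≠ t → Odd (orderOf (s * t)) →
    ∀ T₁ T₂ T₃ : Set W,
      (IsMaxSpherical S T₁ ∧ (T₁ ∩ {s, t}).Nonempty) →
      (IsMaxSpherical S T₂ ∧ (T₂ ∩ {s, t}).Nonempty) →
      (IsMaxSpherical S T₃ ∧ (T₃ ∩ {s, t}).Nonempty) →
      T₁ = T₂ ∨ T₁ = T₃ ∨ T₂ = T₃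

/-- Conditions (0)–(3) of the main theorem. -/
def Conds {W : Type*} [Group W] (S : Set W) : Prop :=
  Cond0 S ∧ Cond1 S ∧ Cond2 S ∧ Cond3 S

/-- `A τ A'`: equality of images in the abelianization of `W'`:
`π'(φ(W_A)) = π'(W'_{A'})`. -/
def Tau {W W' : Type*} [Group W] [Group W'] (φ : W →* W') (A : Set W) (A' : Set W') : Prop :=
  Subgroup.map ((Abelianization.of).comp φ) (Subgroup.closure A) =
  Subgroup.map Abelianization.of (Subgroup.closure A')


set_option linter.unusedSectionVars false

namespace Geo

variable {B : Type} [Fintype B] [DecidableEq B] (M : CoxeterMatrix B)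

/-- Entries of the canonical bilinear form (the value for `M i j = 0` is `-1`). -/
noncomputable def ker (i j : B) : ℝ := -Real.cos (Real.pi / (M i j : ℝ))

/-- Simple roots. -/
def al (i : B) : B → ℝ := Pi.single i 1

/-- pairing with a simple root. -/
noncomputable def bf (i : B) : (B → ℝ) →ₗ[ℝ] ℝ :=
  ∑ j, (ker M i j) • (LinearMap.proj j : (B → ℝ) →ₗ[ℝ] ℝ)

/-- simple reflection. -/
noncomputable def sg (i : B) : Module.End ℝ (B → ℝ) :=
  LinearMap.id - (2 : ℝ) • (bf M i).smulRight (al i)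

lemma ker_symm (i j : B) : ker M i j = ker M j i := by
  unfold ker; rw [M.symmetric i j]

lemma ker_self (i : B) : ker M i i = 1 := by
  unfold ker; simp

lemma bf_apply (i : B) (v : B → ℝ) : bf M i v = ∑ j, ker M i j * v j := by
  simp [bf, LinearMap.sum_apply]

lemma bf_al (i j : B) : bf M i (al j) = ker M i j := by
  rw [bf_apply]; simp [al, Pi.single_apply]

lemma sg_apply (i : B) (v : B → ℝ) : sg M i v = v - (2 * bf M i v) • al i := by
  simp [sg, mul_smul]

lemma sg_apply_ne (i j : B) (h : j ≠ i) (v : B → ℝ) : sg M i v j = v j := by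
  rw [sg_apply]; simp [al, h]

lemma sg_al_self (i : B) : sg M i (al i) = - al i := by
  rw [sg_apply, bf_al, ker_self]; module

lemma bf_sg_self (i : B) (v : B → ℝ) : bf M i (sg M i v) = - bf M i v := by
  rw [sg_apply, map_sub, map_smul, bf_al, ker_self]; simp; ring

lemma sg_sq (i : B) : sg M i * sg M i = 1 := by
  ext1 v
  apply LinearMap.ext; intro v
  simp only [LinearMap.comp_apply, Module.End.mul_apply, Module.End.one_apply]
  rw [sg_apply M i (sg M i _), bf_sg_self, sg_apply]
  module

lemma sg_sg (i : B) (v : B → ℝ) : sg M i (sg M i v) = v := by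
  rw [← Module.End.mul_apply, sg_sq]; rfl

/-- The quadratic form. -/
noncomputable def qf (v : B → ℝ) : ℝ := ∑ i, v i * bf M i v

lemma bf_symm_sum (i : B) (v : B → ℝ) : ∑ j, v j * bf M j (al i) = bf M i v := by
  rw [bf_apply]
  apply Finset.sum_congr rfl
  intro j _
  rw [bf_al, ker_symm]; ring

lemma qf_sg (i : B) (v : B → ℝ) : qf M (sg M i v) = qf M v := by
  have h1 : ∀ c : ℝ, qf M (v - c • al i) = qf M v - 2 * c * bf M i v + c ^ 2 := by
    intro c
    have : ∀ j, (v - c • al i) j * bf M j (v - c • al i)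
        = v j * bf M j v - c * (v j * bf M j (al i)) - c * (al i j * bf M j v)
          + c ^ 2 * (al i j * bf M j (al i)) := by
      intro j; rw [map_sub, map_smul]; simp; ring
    unfold qf
    rw [Finset.sum_congr rfl (fun j _ => this j)]
    rw [Finset.sum_add_distrib, Finset.sum_sub_distrib, Finset.sum_sub_distrib,
      ← Finset.mul_sum, ← Finset.mul_sum, ← Finset.mul_sum, bf_symm_sum]
    have e1 : ∀ w : B → ℝ, ∑ j, al i j * bf M j w = bf M i w := by
      intro w; simp [al, Pi.single_apply]
    rw [e1, e1, bf_al, ker_self]; ring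
  rw [sg_apply, h1]; ring

lemma qf_al (i : B) : qf M (al i) = 1 := by
  unfold qf
  have e1 : ∀ w : B → ℝ, ∑ j, al i j * bf M j w = bf M i w := by
    intro w; simp [al, Pi.single_apply]
  rw [e1, bf_al, ker_self]

/-- Chebyshev-like sequence. -/
noncomputable def pp (c : ℝ) : ℕ → ℝ
  | 0 => 0
  | 1 => 1
  | (n+2) => 2 * c * pp c (n+1) - pp c n

lemma pp_sin (θ : ℝ) (n : ℕ) : pp (Real.cos θ) n * Real.sin θ = Real.sin (n * θ) := by
  induction n using Nat.strong_induction_on with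
  | _ n ih =>
    match n with
    | 0 => simp [pp]
    | 1 => simp [pp]
    | (n+2) =>
      have h1 := ih n (by omega)
      have h2 := ih (n+1) (by omega)
      have : Real.sin (((n+2 : ℕ) : ℝ) * θ) + Real.sin ((n:ℝ) * θ)
        = 2 * Real.cos θ * Real.sin (((n+1 : ℕ) : ℝ) * θ) := by
        push_cast
        have e1 : ((n:ℝ)+2) * θ = ((n:ℝ)+1)*θ + θ := by ring
        have e2 : ((n:ℝ)) * θ = ((n:ℝ)+1)*θ - θ := by ring
        rw [e1, e2, Real.sin_add, Real.sin_sub]; ring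
      rw [pp, sub_mul, h1, mul_assoc, h2]; linarith

lemma pp_one (n : ℕ) : pp 1 n = n := by
  induction n using Nat.strong_induction_on with
  | _ n ih =>
    match n with
    | 0 => simp [pp]
    | 1 => simp [pp]
    | (n+2) =>
      rw [pp, ih n (by omega), ih (n+1) (by omega)]; push_cast; ring

lemma two_le {i j : B} (h : i ≠ j) (h0 : M i j ≠ 0) : 2 ≤ M i j := by
  have := M.off_diagonal i j h
  have h2 : M.M i j ≠ 0 := h0
  show 2 ≤ M.M i j
  omega

lemma sin_pos' {i j : B} (h : i ≠ j) (h0 : M i j ≠ 0) : 0 < Real.sin (Real.pi / (M i j : ℝ)) := by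
  have h2 : (2:ℝ) ≤ (M i j : ℝ) := by exact_mod_cast two_le M h h0
  apply Real.sin_pos_of_pos_of_lt_pi
  · have := Real.pi_pos; positivity
  · rw [div_lt_iff₀ (by linarith)]; nlinarith [Real.pi_pos]

lemma pp_nonneg {i j : B} (h : i ≠ j) (n : ℕ) (hn : M i j = 0 ∨ n ≤ M i j) :
    0 ≤ pp (-ker M i j) n := by
  unfold ker
  rw [neg_neg]
  by_cases h0 : M i j = 0
  · rw [h0]; simp [pp_one]
  · have hn : n ≤ M i j := hn.resolve_left h0
    have hs := sin_pos' M h h0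
    have h1 := pp_sin (Real.pi / (M i j : ℝ)) n
    have h2 : 0 ≤ Real.sin (n * (Real.pi / (M i j : ℝ))) := by
      have h2 : (2:ℝ) ≤ (M i j : ℝ) := by exact_mod_cast two_le M h h0
      have h3 : (n:ℝ) ≤ (M i j : ℝ) := by exact_mod_cast hn
      apply Real.sin_nonneg_of_nonneg_of_le_pi
      · have := Real.pi_pos; positivity
      · rw [← mul_div_assoc, div_le_iff₀ (by linarith)]; nlinarith [Real.pi_pos]
    rw [← h1] at h2
    exact nonneg_of_mul_nonneg_left h2 hs

lemma sg_comb (i j : B) (n : ℕ) :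
    sg M i (pp (-ker M i j) n • al i + pp (-ker M i j) (n+1) • al j)
      = pp (-ker M i j) (n+2) • al i + pp (-ker M i j) (n+1) • al j := by
  rw [map_add, map_smul, map_smul, sg_al_self, sg_apply M i (al j), bf_al, pp]
  module

lemma sg_pow (i j : B) (n : ℕ) :
    ((sg M j * sg M i) ^ n) (al j)
      = pp (-ker M i j) (2*n) • al i + pp (-ker M i j) (2*n+1) • al j := by
  induction n with
  | zero => simp [pp]
  | succ n ih =>
    rw [pow_succ', Module.End.mul_apply, ih, Module.End.mul_apply, sg_comb]
    have := sg_comb M j i (2*n+1)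
    rw [ker_symm M j i] at this
    rw [add_comm, this, add_comm]
    rfl

lemma sg_pow_al (i j : B) (h : i ≠ j) : ((sg M j * sg M i) ^ (M i j)) (al j) = al j := by
  by_cases h0 : M i j = 0
  · rw [h0]; simp
  rw [sg_pow]
  have hs := sin_pos' M h h0
  have hM : (M i j : ℝ) ≠ 0 := by exact_mod_cast h0
  have e1 : pp (-ker M i j) (2 * M i j) = 0 := by
    have h1 := pp_sin (Real.pi / (M i j : ℝ)) (2 * M i j)
    have : ((2 * M i j : ℕ) : ℝ) * (Real.pi / (M i j : ℝ)) = 2 * Real.pi := by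
      push_cast; field_simp
    rw [this, Real.sin_two_pi] at h1
    unfold ker; rw [neg_neg]
    exact (mul_eq_zero.mp h1).resolve_right hs.ne'
  have e2 : pp (-ker M i j) (2 * M i j + 1) = 1 := by
    have h1 := pp_sin (Real.pi / (M i j : ℝ)) (2 * M i j + 1)
    have : ((2 * M i j + 1 : ℕ) : ℝ) * (Real.pi / (M i j : ℝ))
        = Real.pi / (M i j : ℝ) + 2 * Real.pi := by
      push_cast; field_simp; ring
    rw [this, Real.sin_add_two_pi] at h1
    unfold ker; rw [neg_neg]
    exact mul_right_cancel₀ hs.ne' (by rw [h1, one_mul])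
  rw [e1, e2]; simp

lemma sg_inv_pow (i j : B) (n : ℕ) : (sg M i * sg M j) ^ n * (sg M j * sg M i) ^ n = 1 := by
  have h1 : (sg M i * sg M j) * (sg M j * sg M i) = 1 := by
    rw [mul_assoc, ← mul_assoc (sg M j), sg_sq, one_mul, sg_sq]
  have h2 : (sg M j * sg M i) * (sg M i * sg M j) = 1 := by
    rw [mul_assoc, ← mul_assoc (sg M i), sg_sq, one_mul, sg_sq]
  rw [← Commute.mul_pow (by rw [Commute, SemiconjBy, h1, h2]), h1, one_pow]

lemma sg_liftable : M.IsLiftable (sg M) := by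
  intro i j
  by_cases h : i = j
  · subst h; simp [sg_sq]
  by_cases h0 : M i j = 0
  · rw [h0]; simp
  have a1 : ((sg M i * sg M j) ^ (M i j)) (al i) = al i := by
    have := sg_pow_al M j i (Ne.symm h)
    rwa [M.symmetric j i] at this
  have a2 : ((sg M i * sg M j) ^ (M i j)) (al j) = al j := by
    have h1 := sg_pow_al M i j h
    have h2 := sg_inv_pow M i j (M i j)
    calc ((sg M i * sg M j) ^ (M i j)) (al j)
        = ((sg M i * sg M j) ^ (M i j)) (((sg M j * sg M i) ^ (M i j)) (al j)) := by rw [h1]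
      _ = al j := by rw [← Module.End.mul_apply, h2]; rfl
  apply LinearMap.ext
  intro v
  set k := ker M i j with hk
  have hs := sin_pos' M h h0
  have hk1 : 1 - k^2 ≠ 0 := by
    have : 1 - k^2 = Real.sin (Real.pi / (M i j : ℝ)) ^ 2 := by
      rw [hk, ker, Real.sin_sq]; ring
    rw [this]; positivity
  set x := (bf M i v - k * bf M j v) / (1 - k^2) with hx
  set y := (bf M j v - k * bf M i v) / (1 - k^2) with hy
  set u := v - x • al i - y • al j with hu
  have b1 : bf M i u = 0 := by
    rw [hu, map_sub, map_sub, map_smul, map_smul, bf_al, bf_al, ker_self, ← hk, hx, hy]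
    simp only [smul_eq_mul]
    field_simp
    ring
  have b2 : bf M j u = 0 := by
    rw [hu, map_sub, map_sub, map_smul, map_smul, bf_al, bf_al, ker_self, ker_symm M j i, ← hk,
      hx, hy]
    simp only [smul_eq_mul]
    field_simp
    ring
  have c1 : sg M i u = u := by rw [sg_apply, b1]; simp
  have c2 : sg M j u = u := by rw [sg_apply, b2]; simp
  have c3 : ∀ n : ℕ, ((sg M i * sg M j) ^ n) u = u := by
    intro n
    induction n with
    | zero => simp
    | succ n ih => rw [pow_succ', Module.End.mul_apply, ih, Module.End.mul_apply, c2, c1]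
  have hv : v = u + x • al i + y • al j := by rw [hu]; abel
  rw [hv, map_add, map_add, map_smul, map_smul, c3, a1, a2]
  rfl

variable {M} {W : Type} [Group W] (cs : CoxeterSystem M W)

/-- The geometric representation. -/
noncomputable def rep : W →* Module.End ℝ (B → ℝ) := cs.lift ⟨sg M, sg_liftable M⟩

lemma rep_simple (i : B) : rep cs (cs.simple i) = sg M i := by
  simp [rep]

lemma rep_mul_apply (w w' : W) (v : B → ℝ) : rep cs (w * w') v = rep cs w (rep cs w' v) := by
  rw [map_mul]; rfl

lemma rep_inv_apply (w : W) (v : B → ℝ) : rep cs w⁻¹ (rep cs w v) = v := by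
  rw [← rep_mul_apply, inv_mul_cancel, map_one]; rfl

lemma rep_inv_apply' (w : W) (v : B → ℝ) : rep cs w (rep cs w⁻¹ v) = v := by
  rw [← rep_mul_apply, mul_inv_cancel, map_one]; rfl

lemma rep_alt (s t : B) (k : ℕ) :
    rep cs (cs.wordProd (CoxeterSystem.alternatingWord s t k)) (al s) =
      if Even k then pp (-ker M s t) (k+1) • al s + pp (-ker M s t) k • al t
      else pp (-ker M s t) k • al s + pp (-ker M s t) (k+1) • al t := by
  induction k with
  | zero => simp [CoxeterSystem.alternatingWord, pp]
  | succ k ih =>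
    rw [CoxeterSystem.alternatingWord_succ', cs.wordProd_cons, rep_mul_apply, ih, rep_simple]
    by_cases hk : Even k
    · have := sg_comb M t s k
      rw [ker_symm M t s] at this
      rw [if_pos hk, if_pos hk, if_neg (by rwa [Nat.even_add_one, not_not]), add_comm, this,
        add_comm]
    · rw [if_neg hk, if_neg hk, if_pos (by rwa [Nat.even_add_one]), sg_comb]

lemma al_nonneg (i : B) : (0 : B → ℝ) ≤ al i := by
  unfold al
  exact Pi.single_nonneg.mpr zero_le_one

theorem pos (n : ℕ) : ∀ w : W, cs.length w = n → ∀ s : B,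
    cs.length w < cs.length (w * cs.simple s) → 0 ≤ rep cs w (al s) := by
  induction n using Nat.strong_induction_on with
  | _ n ih =>
  intro w hw s hs
  by_cases h1 : w = 1
  · subst h1; rw [map_one]; exact al_nonneg s
  obtain ⟨t, ht⟩ := cs.exists_rightDescent_of_ne_one h1
  have hst : s ≠ t := by
    rintro rfl
    exact absurd hs (not_lt.mpr (le_of_lt ht))
  let P : ℕ → Prop := fun k => ∃ v : W,
    w = v * cs.wordProd (CoxeterSystem.alternatingWord s t k) ∧ cs.length w = cs.length v + k
  have hP1 : P 1 := by
    refine ⟨w * cs.simple t, ?_, ?_⟩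
    · simp [CoxeterSystem.alternatingWord]
    · rw [cs.isRightDescent_iff] at ht; exact ht.symm
  have hPb : ∀ k, P k → k ≤ n := by
    rintro k ⟨v, -, h⟩; omega
  classical
  obtain ⟨k, hk, hk1, hmax⟩ : ∃ k, P k ∧ 1 ≤ k ∧ ¬ P (k+1) := by
    by_contra hcon
    push Not at hcon
    have : ∀ k, 1 ≤ k → P k := by
      intro k hk
      induction k, hk using Nat.le_induction with
      | base => exact hP1
      | succ m hm ihm => exact hcon m ihm hm
    have := hPb _ (this (n+1) (by omega))
    omega
  obtain ⟨v, hv, hl⟩ := hk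
  have hlv : cs.length v < n := by omega
  -- the alternating word's first letter and the other letter both lengthen v
  obtain ⟨k', rfl⟩ : ∃ k', k = k' + 1 := ⟨k - 1, by omega⟩
  have hfirst : cs.length v < cs.length (v * cs.simple (if Even k' then t else s)) := by
    rw [CoxeterSystem.alternatingWord_succ', cs.wordProd_cons, ← mul_assoc] at hv
    have h2 := cs.length_mul_le (v * cs.simple (if Even k' then t else s))
      (cs.wordProd (CoxeterSystem.alternatingWord s t k'))
    rw [← hv] at h2
    have h3 := cs.length_wordProd_le (CoxeterSystem.alternatingWord s t k')
    rw [CoxeterSystem.length_alternatingWord] at h3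
    omega
  have hsecond : cs.length v < cs.length (v * cs.simple (if Even (k'+1) then t else s)) := by
    by_contra hcon
    apply hmax
    refine ⟨v * cs.simple (if Even (k'+1) then t else s), ?_, ?_⟩
    · rw [CoxeterSystem.alternatingWord_succ', cs.wordProd_cons, ← mul_assoc,
        cs.simple_mul_simple_cancel_right]
      exact hv
    · rcases cs.length_mul_simple v (if Even (k'+1) then t else s) with h | h <;> omega
  have hs' : cs.length v < cs.length (v * cs.simple s) := by
    by_cases he : Even k'
    · rwa [if_neg (by rwa [Nat.even_add_one, not_not])] at hsecond
    · rwa [if_neg he] at hfirst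
  have ht' : cs.length v < cs.length (v * cs.simple t) := by
    by_cases he : Even k'
    · rwa [if_pos he] at hfirst
    · rwa [if_pos (by rwa [Nat.even_add_one])] at hsecond
  have ps := ih _ hlv v rfl s hs'
  have pt := ih _ hlv v rfl t ht'
  have hkM : M s t = 0 ∨ k' + 1 + 1 ≤ M s t := by
    by_contra hcon
    push Not at hcon
    have hnr := cs.not_isReduced_alternatingWord t s (m := k'+1+1)
      (by rw [M.symmetric]; exact hcon.1) (by rw [M.symmetric]; exact hcon.2)
    have h3 := cs.length_wordProd_le (CoxeterSystem.alternatingWord t s (k'+1+1))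
    rw [CoxeterSystem.IsReduced] at hnr
    rw [CoxeterSystem.length_alternatingWord] at h3 hnr
    have h4 : w * cs.simple s
        = v * cs.wordProd (CoxeterSystem.alternatingWord t s (k'+1+1)) := by
      rw [CoxeterSystem.alternatingWord_succ t s (k'+1), cs.wordProd_concat, ← mul_assoc, ← hv]
    have h5 := cs.length_mul_le v (cs.wordProd (CoxeterSystem.alternatingWord t s (k'+1+1)))
    rw [← h4] at h5
    omega
  have hp1 : 0 ≤ pp (-ker M s t) (k'+1) := pp_nonneg M hst _ (by omega)
  have hp2 : 0 ≤ pp (-ker M s t) (k'+1+1) := pp_nonneg M hst _ hkM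
  rw [hv, rep_mul_apply, rep_alt]
  split_ifs
  all_goals
    rw [map_add, map_smul, map_smul]
    exact add_nonneg (smul_nonneg (by assumption) ps) (smul_nonneg (by assumption) pt)

theorem neg (w : W) (s : B) (h : cs.length (w * cs.simple s) < cs.length w) :
    rep cs w (al s) ≤ 0 := by
  have h1 := pos cs _ (w * cs.simple s) rfl s (by rwa [cs.simple_mul_simple_cancel_right])
  rw [rep_mul_apply, rep_simple, sg_al_self, map_neg] at h1
  exact neg_nonneg.mp h1

end Geo

namespace Geo

variable {B : Type} [Fintype B] [DecidableEq B] {M : CoxeterMatrix B}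
variable {W : Type} [Group W] (cs : CoxeterSystem M W)

/-- The set of roots. -/
def Phi : Set (B → ℝ) := {β | ∃ (w : W) (i : B), β = rep cs w (al i)}

lemma al_mem (i : B) : al i ∈ Phi cs := ⟨1, i, by rw [map_one]; rfl⟩

lemma rep_mem {β : B → ℝ} (h : β ∈ Phi cs) (w : W) : rep cs w β ∈ Phi cs := by
  obtain ⟨v, i, rfl⟩ := h
  exact ⟨w * v, i, by rw [rep_mul_apply]⟩

lemma sg_mem {β : B → ℝ} (h : β ∈ Phi cs) (i : B) : sg M i β ∈ Phi cs := by
  rw [← rep_simple cs]; exact rep_mem cs h _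

lemma pos_or_neg {β : B → ℝ} (h : β ∈ Phi cs) : 0 ≤ β ∨ β ≤ 0 := by
  obtain ⟨w, i, rfl⟩ := h
  rcases cs.length_mul_simple w i with h | h
  · left; exact pos cs _ w rfl i (by omega)
  · right; exact neg cs w i (by omega)

lemma qf_root {β : B → ℝ} (h : β ∈ Phi cs) : qf M β = 1 := by
  obtain ⟨w, i, rfl⟩ := h
  induction w using cs.simple_induction_left with
  | one => rw [map_one]; exact qf_al M i
  | mul_simple_left w j ih => rw [rep_mul_apply, rep_simple, qf_sg, ih]

lemma root_ne_zero {β : B → ℝ} (h : β ∈ Phi cs) : β ≠ 0 := by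
  rintro rfl
  have := qf_root cs h
  simp [qf] at this

lemma al_ne_nonpos (i : B) : ¬ (al i ≤ (0 : B → ℝ)) := by
  intro h
  have := h i
  simp [al] at this
  linarith

/-- A simple reflection only changes the sign of its own root. -/
lemma eq_al {β : B → ℝ} (h : β ∈ Phi cs) (h0 : 0 ≤ β) (i : B) (hn : sg M i β ≤ 0) :
    β = al i := by
  have h1 : ∀ j, j ≠ i → β j = 0 := by
    intro j hj
    have h2 := hn j
    rw [sg_apply_ne M i j hj] at h2
    exact le_antisymm h2 (h0 j)
  have h2 : β = (β i) • al i := by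
    ext j
    by_cases hj : j = i
    · subst hj; simp [al]
    · rw [h1 j hj]; simp [al, hj]
  have h3 := qf_root cs h
  have h4 : qf M (β i • al i) = (β i) ^ 2 := by
    have : qf M (β i • al i) = (β i)^2 * qf M (al i) := by
      unfold qf
      rw [Finset.mul_sum]
      apply Finset.sum_congr rfl
      intro j _
      rw [map_smul]; simp; ring
    rw [this, qf_al, mul_one]
  rw [← h2, h3] at h4
  have h5 : β i = 1 := by
    have := h0 i
    simp only [Pi.zero_apply] at this
    nlinarith
  rw [h2, h5, one_smul]

/-- Inversion set. -/
def NN (w : W) : Set (B → ℝ) := {β | β ∈ Phi cs ∧ 0 ≤ β ∧ rep cs w β ≤ 0}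

lemma NN_finite (w : W) : (NN cs w).Finite := by
  induction w using cs.simple_induction_left with
  | one =>
    apply Set.Finite.subset Set.finite_empty
    rintro β ⟨h1, h2, h3⟩
    rw [map_one] at h3
    exact root_ne_zero cs h1 (le_antisymm h3 h2)
  | mul_simple_left w j ih =>
    apply Set.Finite.subset (ih.union (Set.finite_singleton (rep cs w⁻¹ (al j))))
    rintro β ⟨h1, h2, h3⟩
    rcases pos_or_neg cs (rep_mem cs h1 w) with h | h
    · right
      rw [rep_mul_apply, rep_simple] at h3
      have := eq_al cs (rep_mem cs h1 w) h j h3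
      rw [Set.mem_singleton_iff, ← this, rep_inv_apply]
    · left; exact ⟨h1, h2, h⟩

/-- Negative set of a functional. -/
def Ng (x : (B → ℝ) →ₗ[ℝ] ℝ) : Set (B → ℝ) := {β | β ∈ Phi cs ∧ 0 ≤ β ∧ x β < 0}

lemma dominant (n : ℕ) : ∀ x : (B → ℝ) →ₗ[ℝ] ℝ, (Ng cs x).Finite → (Ng cs x).ncard = n →
    ∃ w : W, ∀ i, 0 ≤ x (rep cs w (al i)) := by
  induction n using Nat.strong_induction_on with
  | _ n ih =>
  intro x hf hn
  by_cases hd : ∀ i, 0 ≤ x (al i)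
  · exact ⟨1, fun i => by rw [map_one]; exact hd i⟩
  push Not at hd
  obtain ⟨i, hi⟩ := hd
  set x' := x.comp (sg M i) with hx'
  have hinj : Function.Injective (sg M i) := fun a b h => by
    rw [← sg_sg M i a, h, sg_sg]
  have hsub : (sg M i) '' (Ng cs x') ⊆ (Ng cs x) \ {al i} := by
    rintro _ ⟨β, ⟨h1, h2, h3⟩, rfl⟩
    have hne : β ≠ al i := by
      rintro rfl
      rw [hx', LinearMap.comp_apply, sg_al_self, map_neg] at h3
      linarith
    refine ⟨⟨sg_mem cs h1 i, ?_, h3⟩, ?_⟩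
    · rcases pos_or_neg cs (sg_mem cs h1 i) with h | h
      · exact h
      · exact absurd (eq_al cs h1 h2 i h) hne
    · intro h
      rw [Set.mem_singleton_iff] at h
      have : β = - al i := by rw [← sg_sg M i β, h, sg_al_self]
      rw [this] at h2
      exact al_ne_nonpos i (neg_nonneg.mp h2)
  have hmem : al i ∈ Ng cs x := ⟨al_mem cs i, al_nonneg i, hi⟩
  have hf2 : (Ng cs x \ {al i}).Finite := hf.subset Set.diff_subset
  have hf' : (Ng cs x').Finite :=
    (hf2.subset hsub).of_finite_image hinj.injOn
  have hcard : (Ng cs x').ncard < n := by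
    rw [← Set.ncard_image_of_injective _ hinj]
    have h1 := Set.ncard_le_ncard hsub hf2
    have h2 := Set.ncard_diff_singleton_lt_of_mem hmem hf
    omega
  obtain ⟨w, hw⟩ := ih _ hcard x' hf' rfl
  refine ⟨cs.simple i * w, fun j => ?_⟩
  rw [rep_mul_apply, rep_simple]
  exact hw j

lemma func_nonneg {y : (B → ℝ) →ₗ[ℝ] ℝ} (hy : ∀ i, 0 ≤ y (al i)) {v : B → ℝ} (hv : 0 ≤ v) :
    0 ≤ y v := by
  have : v = ∑ i, v i • al i := by
    ext j
    simp [al, Finset.sum_apply, Pi.single_apply]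
  rw [this, map_sum]
  apply Finset.sum_nonneg
  intro i _
  rw [map_smul]
  exact mul_nonneg (hv i) (hy i)

lemma descent_zero {y : (B → ℝ) →ₗ[ℝ] ℝ} (hy : ∀ i, 0 ≤ y (al i)) {v : W}
    (hv : ∀ u, y (rep cs v u) = y u) {i : B} (hi : cs.IsRightDescent v i) : y (al i) = 0 := by
  have h1 := neg cs v i hi
  have h2 := func_nonneg hy (neg_nonneg.mpr h1)
  rw [map_neg, hv] at h2
  linarith [hy i]

lemma fix_simple {y : (B → ℝ) →ₗ[ℝ] ℝ} {i : B} (hi : y (al i) = 0) (u : B → ℝ) :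
    y (rep cs (cs.simple i) u) = y u := by
  rw [rep_simple, sg_apply, map_sub, map_smul, hi]; simp

lemma stab {y : (B → ℝ) →ₗ[ℝ] ℝ} (hy : ∀ i, 0 ≤ y (al i)) (n : ℕ) : ∀ v : W, cs.length v = n →
    (∀ u, y (rep cs v u) = y u) → v ∈ Subgroup.closure (cs.simple '' {i | y (al i) = 0}) := by
  induction n using Nat.strong_induction_on with
  | _ n ih =>
  intro v hn hv
  by_cases h1 : v = 1
  · subst h1; exact one_mem _
  obtain ⟨i, hi⟩ := cs.exists_rightDescent_of_ne_one h1
  have h0 := descent_zero cs hy hv hi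
  have h2 := ih (cs.length (v * cs.simple i)) (by rw [← hn]; exact hi) (v * cs.simple i) rfl
    (fun u => by rw [rep_mul_apply, hv, fix_simple cs h0])
  have h3 : cs.simple i ∈ Subgroup.closure (cs.simple '' {i | y (al i) = 0}) :=
    Subgroup.subset_closure ⟨i, h0, rfl⟩
  have := mul_mem h2 h3
  rwa [cs.simple_mul_simple_cancel_right] at this

theorem tits (H : Subgroup W) [Finite H] : ∃ (g : W) (T : Set B),
    Finite (Subgroup.closure (cs.simple '' T)) ∧
    ∀ h ∈ H, g⁻¹ * h * g ∈ Subgroup.closure (cs.simple '' T) := by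
  classical
  have := Fintype.ofFinite H
  let r0 : (B → ℝ) →ₗ[ℝ] ℝ := ∑ i, LinearMap.proj i
  have hr0 : ∀ v : B → ℝ, 0 ≤ v → v ≠ 0 → 0 < r0 v := by
    intro v hv hne
    have e : r0 v = ∑ i, v i := by simp [r0, LinearMap.sum_apply]
    rw [e]
    obtain ⟨j, hj⟩ := Function.ne_iff.mp hne
    exact Finset.sum_pos' (fun i _ => hv i)
      ⟨j, Finset.mem_univ _, lt_of_le_of_ne (hv j) (Ne.symm hj)⟩
  let x : (B → ℝ) →ₗ[ℝ] ℝ := ∑ h : H, r0.comp (rep cs (h : W))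
  have hx : ∀ v, x v = ∑ h : H, r0 (rep cs (h : W) v) := by
    intro v; simp [x, LinearMap.sum_apply]
  have hxH : ∀ h ∈ H, ∀ v, x (rep cs h v) = x v := by
    intro h hh v
    rw [hx, hx]
    apply Fintype.sum_equiv (Equiv.mulRight (⟨h, hh⟩ : H))
    intro k
    simp [rep_mul_apply]
  have hbad : {β | β ∈ Phi cs ∧ 0 ≤ β ∧ x β ≤ 0}.Finite := by
    apply Set.Finite.subset (Set.finite_iUnion (fun h : H => NN_finite cs (h : W)))
    rintro β ⟨h1, h2, h3⟩
    by_contra hcon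
    rw [Set.mem_iUnion] at hcon
    push Not at hcon
    have : 0 < x β := by
      rw [hx]
      apply Finset.sum_pos
      · intro h _
        apply hr0
        · rcases pos_or_neg cs (rep_mem cs h1 (h : W)) with hh | hh
          · exact hh
          · exact absurd ⟨h1, h2, hh⟩ (hcon h)
        · exact root_ne_zero cs (rep_mem cs h1 _)
      · exact ⟨1, Finset.mem_univ _⟩
    linarith
  have hNg : (Ng cs x).Finite := hbad.subset (fun β h => ⟨h.1, h.2.1, h.2.2.le⟩)
  have hz : {β | β ∈ Phi cs ∧ x β = 0}.Finite := by
    apply Set.Finite.subset (hbad.union (hbad.image (fun v => -v)))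
    rintro β ⟨h1, h2⟩
    rcases pos_or_neg cs h1 with h | h
    · left; exact ⟨h1, h, h2.le⟩
    · right
      refine ⟨-β, ⟨?_, neg_nonneg.mpr h, by rw [map_neg, h2]; simp⟩, neg_neg β⟩
      obtain ⟨w, i, rfl⟩ := h1
      refine ⟨w * cs.simple i, i, ?_⟩
      rw [rep_mul_apply, rep_simple, sg_al_self, map_neg]
  obtain ⟨g, hg⟩ := dominant cs _ x hNg rfl
  let y : (B → ℝ) →ₗ[ℝ] ℝ := x.comp (rep cs g)
  have hy : ∀ i, 0 ≤ y (al i) := hg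
  refine ⟨g, {i | y (al i) = 0}, ?_, ?_⟩
  swap
  · intro h hh
    apply stab cs hy _ _ rfl
    intro u
    show x (rep cs g _) = x (rep cs g u)
    rw [← rep_mul_apply, ← mul_assoc, ← mul_assoc, mul_inv_cancel, one_mul, rep_mul_apply,
      hxH h hh]
  have hfix : ∀ w ∈ Subgroup.closure (cs.simple '' {i | y (al i) = 0}), ∀ u,
      y (rep cs w u) = y u := by
    intro w hw
    induction hw using Subgroup.closure_induction with
    | mem w hw =>
      obtain ⟨i, hi, rfl⟩ := hw
      exact fix_simple cs hi
    | one => intro u; rw [map_one]; rfl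
    | mul a b _ _ ha hb => intro u; rw [rep_mul_apply, ha, hb]
    | inv a _ ha => intro u; rw [← ha, rep_inv_apply']
  have hz' : {β | β ∈ Phi cs ∧ y β = 0}.Finite := by
    apply Set.Finite.subset (hz.image (rep cs g⁻¹))
    rintro β ⟨h1, h2⟩
    exact ⟨rep cs g β, ⟨rep_mem cs h1 g, h2⟩, rep_inv_apply cs g β⟩
  have := hz'.to_subtype
  let Z := {β | β ∈ Phi cs ∧ y β = 0}
  let F : Subgroup.closure (cs.simple '' {i | y (al i) = 0}) → (Z → Z) := fun w β =>
    ⟨rep cs (w : W) β.1, rep_mem cs β.2.1 _, by rw [hfix _ w.2]; exact β.2.2⟩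
  apply Finite.of_injective F
  intro w1 w2 h12
  by_contra hne
  have hne' : (w1 : W)⁻¹ * w2 ≠ 1 := by
    intro h
    apply hne
    exact Subtype.ext (inv_mul_eq_one.mp h)
  obtain ⟨i, hi⟩ := cs.exists_rightDescent_of_ne_one hne'
  have hmem := mul_mem (inv_mem w1.2) w2.2
  have h0 := descent_zero cs hy (hfix _ hmem) hi
  have h1 := neg cs _ i hi
  have h2 : rep cs (w1 : W) (al i) = rep cs (w2 : W) (al i) :=
    congrArg Subtype.val (congrFun h12 ⟨al i, al_mem cs i, h0⟩)
  rw [rep_mul_apply, ← h2, rep_inv_apply] at h1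
  exact al_ne_nonpos i h1

end Geo

namespace SE

variable {W : Type} [Group W] {S : Set W}

lemma tits' (hS : IsCoxGenSet S) (H : Subgroup W) [Finite H] :
    ∃ (g : W) (T : Set W), T ⊆ S ∧ Finite (Subgroup.closure T) ∧
      ∀ h ∈ H, g⁻¹ * h * g ∈ Subgroup.closure T := by
  classical
  obtain ⟨hf, M, cs, hcs⟩ := hS
  have : Fintype S := hf.fintype
  obtain ⟨g, T, h1, h2⟩ := Geo.tits cs H
  refine ⟨g, cs.simple '' T, ?_, h1, h2⟩
  rintro _ ⟨s, _, rfl⟩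
  rw [hcs]; exact s.2

lemma sq (hS : IsCoxGenSet S) {s : W} (hs : s ∈ S) : s * s = 1 := by
  obtain ⟨hf, M, cs, hcs⟩ := hS
  have := cs.simple_mul_simple_self ⟨s, hs⟩
  rwa [hcs] at this

lemma inv_eq (hS : IsCoxGenSet S) {s : W} (hs : s ∈ S) : s⁻¹ = s :=
  inv_eq_of_mul_eq_one_left (sq hS hs)

lemma clo (hS : IsCoxGenSet S) : Subgroup.closure S = ⊤ := by
  obtain ⟨hf, M, cs, hcs⟩ := hS
  rw [← cs.subgroup_closure_range_simple]
  congr 1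
  ext x
  constructor
  · intro hx; exact ⟨⟨x, hx⟩, hcs _⟩
  · rintro ⟨s, rfl⟩; rw [hcs]; exact s.2

lemma lift' (hS : IsCoxGenSet S) {G : Type} [Group G] (f : W → G)
    (h1 : ∀ s ∈ S, f s * f s = 1)
    (h2 : ∀ s ∈ S, ∀ t ∈ S, s ≠ t → (f s * f t) ^ orderOf (s * t) = 1) :
    ∃ φ : W →* G, ∀ s ∈ S, φ s = f s := by
  obtain ⟨hf, M, cs, hcs⟩ := hS
  have hl : M.IsLiftable (fun s : S => f s) := by
    intro s t
    by_cases hst : s = t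
    · subst hst
      simp [h1 s s.2]
    · have hd : orderOf ((s : W) * t) ∣ M s t := by
        apply orderOf_dvd_of_pow_eq_one
        have := cs.simple_mul_simple_pow s t
        rwa [hcs, hcs] at this
      obtain ⟨k, hk⟩ := hd
      show (f s * f t) ^ M s t = 1
      rw [hk, pow_mul, h2 s s.2 t t.2 (fun h => hst (Subtype.ext h)), one_pow]
  refine ⟨cs.lift ⟨_, hl⟩, fun s hs => ?_⟩
  have := cs.lift_apply_simple hl ⟨s, hs⟩
  rwa [hcs] at this

lemma hom_ext (hS : IsCoxGenSet S) {G : Type} [Group G] {f g : W →* G}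
    (h : ∀ s ∈ S, f s = g s) : f = g :=
  MonoidHom.eq_of_eqOn_dense (clo hS) h

lemma ind (hS : IsCoxGenSet S) {p : W → Prop} (h1 : p 1) (hs : ∀ s ∈ S, p s)
    (hm : ∀ x y, p x → p y → p (x * y)) (hi : ∀ x, p x → p x⁻¹) (w : W) : p w := by
  have hw : w ∈ Subgroup.closure S := by rw [clo hS]; trivial
  induction hw using Subgroup.closure_induction with
  | mem x hx => exact hs x hx
  | one => exact h1
  | mul x y _ _ hx hy => exact hm x y hx hy
  | inv x _ hx => exact hi x hx

lemma bound (hS : IsCoxGenSet S) : ∃ N : ℕ, ∀ H : Subgroup W, Finite H → Nat.card H ≤ N := by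
  have hf : {T | T ⊆ S}.Finite := hS.1.finite_subsets
  obtain ⟨N, hN⟩ := (hf.image (fun T => Nat.card (Subgroup.closure T))).bddAbove
  refine ⟨N, fun H hH => ?_⟩
  obtain ⟨g, T, hT, hfin, hg⟩ := tits' hS H
  refine le_trans ?_ (hN ⟨T, hT, rfl⟩)
  refine Nat.card_le_card_of_injective
    (fun h : H => (⟨g⁻¹ * h * g, hg h h.2⟩ : Subgroup.closure T)) ?_
  intro a b hab
  simpa using hab

lemma exists_max (hS : IsCoxGenSet S) (p : Subgroup W → Prop) (hp : ∀ H, p H → Finite H)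
    (H : Subgroup W) (hH : p H) : ∃ G, H ≤ G ∧ p G ∧ ∀ K, p K → G ≤ K → K = G := by
  obtain ⟨N, hN⟩ := bound hS
  by_contra hcon
  have key : ∀ n : ℕ, ∃ G, H ≤ G ∧ p G ∧ n ≤ Nat.card G := by
    intro n
    induction n with
    | zero => exact ⟨H, le_rfl, hH, Nat.zero_le _⟩
    | succ n ih =>
      obtain ⟨G, h1, h2, h3⟩ := ih
      by_contra hc
      apply hcon
      refine ⟨G, h1, h2, fun K hK hGK => ?_⟩
      by_contra hne
      apply hc
      refine ⟨K, h1.trans hGK, hK, ?_⟩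
      have := hp K hK
      have hlt : (G : Set W) ⊂ K := ⟨hGK, fun h => hne (le_antisymm h hGK)⟩
      have := Set.ncard_lt_ncard hlt (Set.toFinite _)
      exact lt_of_le_of_lt h3 this
  obtain ⟨G, _, h2, h3⟩ := key (N + 1)
  have := hN G (hp G h2)
  omega

/-- maximal finite subgroups -/
def IsMF (G : Subgroup W) : Prop := Finite G ∧ ∀ K : Subgroup W, Finite K → G ≤ K → K = G

lemma exists_mf (hS : IsCoxGenSet S) (H : Subgroup W) (hH : Finite H) : ∃ G, H ≤ G ∧ IsMF G := by
  obtain ⟨G, h1, h2, h3⟩ := exists_max hS (fun H => Finite H) (fun _ h => h) H hH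
  exact ⟨G, h1, h2, h3⟩

lemma mf_eq (hS : IsCoxGenSet S) {G : Subgroup W} (hG : IsMF G) :
    ∃ (g : W) (T : Set W), T ⊆ S ∧ Finite (Subgroup.closure T) ∧
      ∀ x, x ∈ G ↔ g⁻¹ * x * g ∈ Subgroup.closure T := by
  have := hG.1
  obtain ⟨g, T, hT, hfin, hg⟩ := tits' hS G
  refine ⟨g, T, hT, hfin, fun x => ⟨hg x, fun hx => ?_⟩⟩
  let K : Subgroup W := (Subgroup.closure T).comap (MulAut.conj g⁻¹).toMonoidHom
  have hK : ∀ x, x ∈ K ↔ g⁻¹ * x * g ∈ Subgroup.closure T := by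
    intro x; simp [K, Subgroup.mem_comap]
  have hKf : Finite K := by
    refine Finite.of_injective
      (fun h : K => (⟨g⁻¹ * h * g, (hK h).1 h.2⟩ : Subgroup.closure T)) ?_
    intro a b hab
    simpa using hab
  have := hG.2 K hKf (fun x hx => (hK x).2 (hg x hx))
  rw [← this]
  exact (hK x).2 hx

end SE

namespace SE

variable {W : Type} [Group W] {S : Set W}

/-- strong even Coxeter generating set -/
def SEv (S : Set W) : Prop := IsCoxGenSet S ∧ IsStrongEvenSet S

lemma SEv.pow_one (h : SEv S) {G : Type} [Group G] {s t : W} (hs : s ∈ S) (ht : t ∈ S)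
    (hst : s ≠ t) {x : G} (hx : x * x = 1) : x ^ orderOf (s * t) = 1 := by
  have : 2 ∣ orderOf (s * t) := by
    rcases h.2 s hs t ht hst with h | h <;> omega
  obtain ⟨k, hk⟩ := this
  rw [hk, pow_mul, pow_two, hx, one_pow]

open Classical in
lemma exists_q (h : SEv S) (U : Set W) :
    ∃ φ : W →* W, ∀ s ∈ S, φ s = if s ∈ U then s else 1 := by
  refine lift' h.1 (fun s => if s ∈ U then s else 1) ?_ ?_
  · intro s hs
    have := sq h.1 hs
    split_ifs <;> simp [this]
  · intro s hs t ht hst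
    split_ifs
    · exact pow_orderOf_eq_one _
    · apply h.pow_one hs ht hst; simpa using sq h.1 hs
    · apply h.pow_one hs ht hst; simpa using sq h.1 ht
    · simp

open Classical in
lemma exists_chi (h : SEv S) (r : W) :
    ∃ φ : W →* ℤˣ, ∀ s ∈ S, φ s = if s = r then -1 else 1 := by
  refine lift' h.1 (fun s => if s = r then -1 else 1) ?_ ?_
  · intro s hs
    split_ifs <;> simp
  · intro s hs t ht hst
    apply h.pow_one hs ht hst
    exact Int.units_mul_self _

/-- retraction -/
noncomputable def q (h : SEv S) (U : Set W) : W →* W := Classical.choose (exists_q h U)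

/-- sign character -/
noncomputable def chi (h : SEv S) (r : W) : W →* ℤˣ := Classical.choose (exists_chi h r)

lemma q_mem (h : SEv S) {U : Set W} {s : W} (hs : s ∈ S) (hU : s ∈ U) : q h U s = s := by
  have := Classical.choose_spec (exists_q h U) s hs
  rwa [if_pos hU] at this

lemma q_not (h : SEv S) {U : Set W} {s : W} (hs : s ∈ S) (hU : s ∉ U) : q h U s = 1 := by
  have := Classical.choose_spec (exists_q h U) s hs
  rwa [if_neg hU] at this

lemma chi_self (h : SEv S) {s : W} (hs : s ∈ S) : chi h s s = -1 := by
  have := Classical.choose_spec (exists_chi h s) s hs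
  rwa [if_pos rfl] at this

lemma chi_ne (h : SEv S) {s t : W} (ht : t ∈ S) (hst : t ≠ s) : chi h s t = 1 := by
  have := Classical.choose_spec (exists_chi h s) t ht
  rwa [if_neg hst] at this

lemma chi_conj (h : SEv S) (s g x : W) : chi h s (g * x * g⁻¹) = chi h s x := by
  rw [map_mul, map_mul, map_inv, mul_comm, inv_mul_cancel_left]

lemma chi_conj' (h : SEv S) (s g x : W) : chi h s (g⁻¹ * x * g) = chi h s x := by
  rw [map_mul, map_mul, map_inv, mul_comm, mul_inv_cancel_left]

lemma chi_or (h : SEv S) (s x : W) : chi h s x = 1 ∨ chi h s x = -1 := Int.units_eq_one_or _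

/-- `q U w` lies in the parabolic -/
lemma q_range (h : SEv S) (U : Set W) (w : W) : q h U w ∈ Subgroup.closure U := by
  refine ind h.1 (p := fun w => q h U w ∈ Subgroup.closure U) ?_ ?_ ?_ ?_ w
  · simp
  · intro s hs
    by_cases hU : s ∈ U
    · rw [q_mem h hs hU]; exact Subgroup.subset_closure hU
    · rw [q_not h hs hU]; exact one_mem _
  · intro x y hx hy; rw [map_mul]; exact mul_mem hx hy
  · intro x hx; rw [map_inv]; exact inv_mem hx

lemma q_fix (h : SEv S) {U T : Set W} (hU : U ⊆ S) (hTU : U ⊆ T) {w : W}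
    (hw : w ∈ Subgroup.closure U) : q h T w = w := by
  induction hw using Subgroup.closure_induction with
  | mem x hx => exact q_mem h (hU hx) (hTU hx)
  | one => simp
  | mul x y _ _ hx hy => rw [map_mul, hx, hy]
  | inv x _ hx => rw [map_inv, hx]

lemma chi_q (h : SEv S) {U : Set W} {s : W} (hs : s ∈ U) (w : W) :
    chi h s (q h U w) = chi h s w := by
  have : (chi h s).comp (q h U) = chi h s := by
    apply hom_ext h.1
    intro t ht
    by_cases hU : t ∈ U
    · simp [q_mem h ht hU]
    · have hne : t ≠ s := fun e => hU (e ▸ hs)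
      simp [q_not h ht hU, chi_ne h ht hne]
  exact DFunLike.congr_fun this w

lemma chi_clo (h : SEv S) {U : Set W} (hU : U ⊆ S) {s : W} (hs : s ∉ U) {w : W}
    (hw : w ∈ Subgroup.closure U) : chi h s w = 1 := by
  induction hw using Subgroup.closure_induction with
  | mem x hx => exact chi_ne h (hU hx) (fun e => hs (e ▸ hx))
  | one => simp
  | mul x y _ _ hx hy => rw [map_mul, hx, hy, mul_one]
  | inv x _ hx => rw [map_inv, hx, inv_one]

lemma chi_comm (h : SEv S) (s : W) {w : W} (hw : w ∈ commutator W) : chi h s w = 1 := by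
  have : commutator W ≤ (chi h s).ker := Abelianization.commutator_subset_ker _
  exact this hw

lemma clo_comm {A B : Set W} (hAB : ∀ a ∈ A, ∀ b ∈ B, a * b = b * a) {x y : W}
    (hx : x ∈ Subgroup.closure A) (hy : y ∈ Subgroup.closure B) : x * y = y * x := by
  have h1 : ∀ a ∈ A, ∀ y ∈ Subgroup.closure B, a * y = y * a := by
    intro a ha y hy
    have : Subgroup.closure B ≤ Subgroup.centralizer {a} := by
      rw [Subgroup.closure_le]
      intro b hb
      rw [SetLike.mem_coe, Subgroup.mem_centralizer_singleton_iff]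
      exact (hAB a ha b hb).symm
    have := this hy
    rw [Subgroup.mem_centralizer_singleton_iff] at this
    exact this.symm
  have : Subgroup.closure A ≤ Subgroup.centralizer {y} := by
    rw [Subgroup.closure_le]
    intro b hb
    rw [SetLike.mem_coe, Subgroup.mem_centralizer_singleton_iff]
    exact h1 b hb y hy
  have := this hx
  rw [Subgroup.mem_centralizer_singleton_iff] at this
  exact this

lemma q_union (h : SEv S) {A B : Set W} (hd : ∀ a ∈ A, a ∉ B)
    (hAB : ∀ a ∈ A, ∀ b ∈ B, a * b = b * a) (w : W) :
    q h (A ∪ B) w = q h A w * q h B w := by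
  refine ind h.1 (p := fun w => q h (A ∪ B) w = q h A w * q h B w) ?_ ?_ ?_ ?_ w
  · simp
  · intro s hs
    by_cases hA : s ∈ A
    · rw [q_mem h hs hA, q_not h hs (hd s hA), q_mem h hs (Or.inl hA), mul_one]
    · by_cases hB : s ∈ B
      · rw [q_mem h hs hB, q_not h hs hA, q_mem h hs (Or.inr hB), one_mul]
      · rw [q_not h hs hA, q_not h hs hB, q_not h hs (by simp [hA, hB]), mul_one]
  · intro x y hx hy
    simp only [map_mul, hx, hy]
    have := clo_comm hAB (q_range h A y) (q_range h B x)
    simp only [mul_assoc]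
    rw [← mul_assoc (q h A y), this, mul_assoc]
  · intro x hx
    simp only [map_inv, hx]
    rw [clo_comm hAB (q_range h A x) (q_range h B x), mul_inv_rev]

open Classical in
lemma prod_form (h : SEv S) (w : W) :
    Abelianization.of w =
      ∏ s ∈ h.1.1.toFinset, if chi h s w = -1 then Abelianization.of s else 1 := by
  have hsq : ∀ s ∈ S, (Abelianization.of s) * Abelianization.of s = 1 := by
    intro s hs; rw [← map_mul, sq h.1 hs, map_one]
  refine ind h.1 (p := fun w => Abelianization.of w =
      ∏ s ∈ h.1.1.toFinset, if chi h s w = -1 then Abelianization.of s else 1) ?_ ?_ ?_ ?_ w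
  · simp
  · intro s hs
    rw [Finset.prod_eq_single s]
    · rw [if_pos (chi_self h hs)]
    · intro b hb hbs
      rw [chi_ne h hs hbs.symm, if_neg (by decide)]
    · intro hn; simp [hs] at hn
  · intro x y hx hy
    rw [map_mul, hx, hy, ← Finset.prod_mul_distrib]
    apply Finset.prod_congr rfl
    intro s hs
    have hs' : s ∈ S := by simpa using hs
    rw [map_mul]
    rcases chi_or h s x with e | e <;> rcases chi_or h s y with e' | e' <;>
      simp [e, e', hsq s hs']
  · intro x hx
    rw [map_inv, hx, ← Finset.prod_inv_distrib]
    apply Finset.prod_congr rfl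
    intro s hs
    have hs' : s ∈ S := by simpa using hs
    rw [map_inv, Int.units_inv_eq_self]
    split_ifs
    · exact inv_eq_of_mul_eq_one_left (hsq s hs')
    · simp

/-- elements whose relevant characters vanish lie in any big subgroup -/
lemma P_le (h : SEv S) {N : Subgroup W} (hc : commutator W ≤ N) {w : W}
    (hw : ∀ s ∈ S, s ∉ N → chi h s w = 1) : w ∈ N := by
  classical
  have h1 : Abelianization.of w ∈ N.map Abelianization.of := by
    rw [prod_form h w]
    apply Subgroup.prod_mem
    intro s hs
    have hs' : s ∈ S := by simpa using hs
    split_ifs with e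
    · refine ⟨s, ?_, rfl⟩
      by_contra hn
      rw [hw s hs' hn] at e
      exact absurd e (by decide)
    · exact one_mem _
  have h2 := Subgroup.comap_map_eq_self (f := (Abelianization.of : W →* Abelianization W)) (H := N)
    (by rw [Abelianization.ker_of]; exact hc)
  rw [← h2]
  exact h1

/-- subgroups generated by a subset of `S` and the commutator subgroup -/
def Good (S : Set W) (N : Subgroup W) : Prop :=
  commutator W ≤ N ∧ ∀ w ∈ N, ∀ H : Subgroup W, commutator W ≤ H → (∀ s ∈ S, s ∈ N → s ∈ H) → w ∈ H

lemma good_iff (h : SEv S) (N : Subgroup W) :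
    Good S N ↔ commutator W ≤ N ∧ ∀ w ∈ N, ∀ s ∈ S, s ∉ N → chi h s w = 1 := by
  constructor
  · rintro ⟨h1, h2⟩
    refine ⟨h1, fun w hw s hs hsN => ?_⟩
    refine h2 w hw (chi h s).ker (Abelianization.commutator_subset_ker _) ?_
    intro t ht htN
    exact chi_ne h ht (fun e => hsN (e ▸ htN))
  · rintro ⟨h1, h2⟩
    refine ⟨h1, fun w hw H hH hN => P_le h hH fun s hs hsH => h2 w hw s hs fun hsN => hsH (hN s hs hsN)⟩

lemma good_sInf (h : SEv S) (F : Set (Subgroup W)) (hF : ∀ N ∈ F, Good S N) : Good S (sInf F) := by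
  rw [good_iff h]
  refine ⟨le_sInf fun N hN => (hF N hN).1, fun w hw s hs hsN => ?_⟩
  rw [Subgroup.mem_sInf] at hw hsN
  push Not at hsN
  obtain ⟨N, hN, hs'⟩ := hsN
  exact ((good_iff h N).1 (hF N hN)).2 w (hw N hN) s hs hs'

lemma good_top (S : Set W) (h : SEv S) : Good S (⊤ : Subgroup W) := by
  rw [good_iff h]
  exact ⟨le_top, fun w _ s _ hs => absurd (Subgroup.mem_top s) hs⟩

/-- recognise a good subgroup: generated by `V` and the commutators -/
lemma good_of (h : SEv S) {N : Subgroup W} {V : Set W} (hc : commutator W ≤ N)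
    (hVN : V ⊆ N) (hN : ∀ w ∈ N, ∀ s ∈ S, s ∉ V → chi h s w = 1) :
    Good S N ∧ ∀ s ∈ S, s ∈ N ↔ s ∈ V := by
  have key : ∀ s ∈ S, s ∈ N ↔ s ∈ V := by
    intro s hs
    refine ⟨fun hsN => ?_, fun hs => hVN hs⟩
    by_contra hsV
    have := hN s hsN s hs hsV
    rw [chi_self h hs] at this
    exact absurd this (by decide)
  refine ⟨?_, key⟩
  rw [good_iff h]
  exact ⟨hc, fun w hw s hs hsN => hN w hw s hs fun hV => hsN (hVN hV)⟩

/-- cardinality of the quotient -/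
lemma good_card (h : SEv S) {N : Subgroup W} (hN : Good S N) :
    (commutator W).relIndex N = 2 ^ Nat.card {s : S // (s : W) ∈ N} := by
  classical
  have : Finite S := h.1.1
  have : Fintype {s : S // (s : W) ∈ N} := Fintype.ofFinite _
  let f : N →* ({s : S // (s : W) ∈ N} → ℤˣ) := MonoidHom.pi
    (fun s => (chi h (s.1 : W)).comp N.subtype)
  have hf : ∀ (x : N) s, f x s = chi h (s.1 : W) x := fun x s => rfl
  have hker : f.ker = (commutator W).subgroupOf N := by
    ext x
    rw [MonoidHom.mem_ker, Subgroup.mem_subgroupOf]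
    constructor
    · intro hx
      apply P_le h le_rfl
      intro s hs _
      by_cases hsN : s ∈ N
      · have := congrFun hx ⟨⟨s, hs⟩, hsN⟩
        exact this
      · exact ((good_iff h N).1 hN).2 x x.2 s hs hsN
    · intro hx
      funext s
      exact chi_comm h _ hx
  have hsurj : f.range = ⊤ := by
    rw [eq_top_iff]
    intro g _
    rw [← Finset.univ_prod_mulSingle g]
    apply Subgroup.prod_mem
    intro s _
    rcases Int.units_eq_one_or (g s) with e | e
    · rw [e, Pi.mulSingle_one]; exact one_mem _
    · refine ⟨⟨s.1, s.2⟩, ?_⟩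
      funext t
      rw [hf, e]
      by_cases hts : t = s
      · subst hts
        rw [Pi.mulSingle_eq_same]; exact chi_self h t.1.2
      · rw [Pi.mulSingle_eq_of_ne hts]
        apply chi_ne h s.1.2
        intro e; exact hts (Subtype.ext (Subtype.ext e.symm))
  have : f.ker.index = Nat.card f.range := Subgroup.index_ker f
  rw [Subgroup.relIndex, ← hker, this, hsurj, Nat.card_congr (Subgroup.topEquiv.toEquiv)]
  rw [Nat.card_fun]
  congr 1
  simp

end SE

namespace SE

variable {W : Type} [Group W] {S S' : Set W}

lemma card_eq_of_good (h : SEv S) (h' : SEv S') {N : Subgroup W} (hN : Good S N) (hN' : Good S' N) :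
    Nat.card {s : S // (s : W) ∈ N} = Nat.card {s : S' // (s : W) ∈ N} := by
  have h1 := good_card h hN
  rw [good_card h' hN'] at h1
  exact (Nat.pow_right_injective le_rfl h1).symm

lemma card_split {X : Type} [Finite X] {Y : Type} (c : X → Y) (F : Finset Y) :
    Nat.card {x : X // c x ∈ F} = ∑ Q ∈ F, Nat.card {x : X // c x = Q} := by
  classical
  have : Fintype X := Fintype.ofFinite X
  simp only [Nat.card_eq_fintype_card, Fintype.card_subtype]
  rw [Finset.card_eq_sum_card_fiberwise (f := c) (t := F)]
  · apply Finset.sum_congr rfl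
    intro Q hQ
    congr 1
    ext x
    simp only [Finset.mem_filter, Finset.mem_univ, true_and]
    constructor
    · exact fun h => h.2
    · intro h; exact ⟨h ▸ hQ, h⟩
  · intro x hx; simpa using hx

/-- abstract matching -/
lemma match_fibers {X X' Y : Type} [Finite X] [Finite X'] [PartialOrder Y] (c : X → Y) (c' : X' → Y)
    (F : Finset Y) (hc : ∀ x, c x ∈ F) (hc' : ∀ x, c' x ∈ F)
    (hcard : ∀ Q ∈ F, Nat.card {x // c x ≤ Q} = Nat.card {x // c' x ≤ Q}) :
    ∃ ψ : X ≃ X', ∀ x, c' (ψ x) = c x := by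
  classical
  have key : ∀ n : ℕ, ∀ Q ∈ F, (F.filter (· < Q)).card = n →
      Nat.card {x // c x = Q} = Nat.card {x // c' x = Q} := by
    intro n
    induction n using Nat.strong_induction_on with
    | _ n ih =>
    intro Q hQ hn
    have e1 : ∀ {X : Type} [Finite X] (c : X → Y), (∀ x, c x ∈ F) →
        Nat.card {x // c x ≤ Q} = Nat.card {x // c x = Q} +
          ∑ R ∈ F.filter (· < Q), Nat.card {x // c x = R} := by
      intro X _ c hc
      have := card_split c (F.filter (· ≤ Q))
      have e2 : F.filter (· ≤ Q) = insert Q (F.filter (· < Q)) := by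
        ext R
        simp only [Finset.mem_filter, Finset.mem_insert, le_iff_lt_or_eq]
        constructor
        · rintro ⟨h1, h2 | h2⟩
          · exact Or.inr ⟨h1, h2⟩
          · exact Or.inl h2
        · rintro (h1 | ⟨h1, h2⟩)
          · subst h1; exact ⟨hQ, Or.inr rfl⟩
          · exact ⟨h1, Or.inl h2⟩
      rw [e2, Finset.sum_insert (by simp), ← e2] at this
      rw [← this]
      apply Nat.card_congr
      apply Equiv.subtypeEquivRight
      intro x
      simp [hc x]
    have a1 := e1 c hc
    have a2 := e1 c' hc'
    have a3 : ∑ R ∈ F.filter (· < Q), Nat.card {x // c x = R} =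
        ∑ R ∈ F.filter (· < Q), Nat.card {x // c' x = R} := by
      apply Finset.sum_congr rfl
      intro R hR
      rw [Finset.mem_filter] at hR
      refine ih _ ?_ R hR.1 rfl
      rw [← hn]
      apply Finset.card_lt_card
      refine ⟨?_, ?_⟩
      · intro P hP
        rw [Finset.mem_filter] at hP ⊢
        exact ⟨hP.1, hP.2.trans hR.2⟩
      · intro hsub
        have := hsub (Finset.mem_filter.2 ⟨hR.1, hR.2⟩)
        rw [Finset.mem_filter] at this
        exact lt_irrefl _ this.2
    have := hcard Q hQ
    omega
  have key2 : ∀ Q : Y, Nonempty ({x // c x = Q} ≃ {x // c' x = Q}) := by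
    intro Q
    by_cases hQ : Q ∈ F
    · exact Finite.card_eq.1 (key _ Q hQ rfl)
    · have i1 : IsEmpty {x // c x = Q} := ⟨fun x => hQ (x.2 ▸ hc x.1)⟩
      have i2 : IsEmpty {x // c' x = Q} := ⟨fun x => hQ (x.2 ▸ hc' x.1)⟩
      exact ⟨Equiv.equivOfIsEmpty _ _⟩
  have e := fun Q => Classical.choice (key2 Q)
  refine ⟨((Equiv.sigmaFiberEquiv c).symm.trans (Equiv.sigmaCongrRight e)).trans
    (Equiv.sigmaFiberEquiv c'), fun x => ?_⟩
  exact (e (c x) ⟨x, rfl⟩).2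

lemma good_finite (h : SEv S) : {N : Subgroup W | Good S N}.Finite := by
  refine Set.Finite.of_finite_image (f := fun N : Subgroup W => S ∩ (N : Set W)) ?_ ?_
  · refine h.1.1.finite_subsets.subset ?_
    rintro _ ⟨N, _, rfl⟩
    exact Set.inter_subset_left
  · intro N hN M hM hNM
    have hNM : S ∩ (N : Set W) = S ∩ (M : Set W) := hNM
    have hiff : ∀ s ∈ S, s ∈ N ↔ s ∈ M := by
      intro s hs
      have := Set.ext_iff.1 hNM s
      simpa [hs] using this
    apply le_antisymm
    · intro w hw
      exact hN.2 w hw M hM.1 fun s hs hsN => (hiff s hs).1 hsN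
    · intro w hw
      exact hM.2 w hw N hN.1 fun s hs hsN => (hiff s hs).2 hsN

theorem matching (h : SEv S) (h' : SEv S') : ∃ ψ : S ≃ S', ∀ N : Subgroup W, Good S N → Good S' N →
    ∀ s : S, (s : W) ∈ N ↔ (ψ s : W) ∈ N := by
  have : Finite S := h.1.1
  have : Finite S' := h'.1.1
  let FF : Set (Subgroup W) := {N | Good S N ∧ Good S' N}
  have hFF : FF.Finite := (good_finite h).subset fun N hN => hN.1
  let cl : W → Subgroup W := fun w => sInf {N | N ∈ FF ∧ w ∈ N}
  have hcl : ∀ w, cl w ∈ FF := fun w =>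
    ⟨good_sInf h _ fun N hN => hN.1.1, good_sInf h' _ fun N hN => hN.1.2⟩
  have hle : ∀ w, ∀ N ∈ FF, cl w ≤ N ↔ w ∈ N := by
    intro w N hN
    constructor
    · intro hwN
      apply hwN
      show w ∈ sInf _
      rw [Subgroup.mem_sInf]
      exact fun M hM => hM.2
    · intro hw
      exact sInf_le ⟨hN, hw⟩
  obtain ⟨ψ, hψ⟩ := match_fibers (fun s : S => cl s) (fun s : S' => cl s) hFF.toFinset
    (fun s => by simpa using hcl s) (fun s => by simpa using hcl s) (by
      intro Q hQ
      have hQ' : Q ∈ FF := by simpa using hQ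
      rw [Nat.card_congr (Equiv.subtypeEquivRight fun s : S => hle s Q hQ'),
        Nat.card_congr (Equiv.subtypeEquivRight fun s : S' => hle s Q hQ')]
      exact card_eq_of_good h h' hQ'.1 hQ'.2)
  refine ⟨ψ, fun N h1 h2 s => ?_⟩
  rw [← hle _ N ⟨h1, h2⟩, ← hle _ N ⟨h1, h2⟩]
  have := hψ s
  rw [this]

end SE

namespace SE

variable {W : Type} [Group W] {S : Set W}

lemma comm_of_two {s t : W} (hs : s * s = 1) (ht : t * t = 1) (h : (s * t) ^ 2 = 1) :
    s * t = t * s := by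
  have e : s * t * (s * t) = 1 := by rw [← pow_two]; exact h
  have h1 := eq_inv_of_mul_eq_one_left e
  rw [mul_inv_rev, inv_eq_of_mul_eq_one_left hs, inv_eq_of_mul_eq_one_left ht] at h1
  exact h1

lemma two_of_comm {s t : W} (hs : s * s = 1) (ht : t * t = 1) (h : s * t = t * s) :
    (s * t) ^ 2 = 1 := by
  rw [pow_two, mul_assoc, ← mul_assoc t, ← h, mul_assoc s t t, ht, mul_one, hs]

lemma four_dvd (h : SEv S) {s t : W} (hs : s ∈ S) (ht : t ∈ S) (hst : s * t ≠ t * s) :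
    4 ∣ orderOf (s * t) := by
  rcases h.2 s hs t ht (fun e => hst (by rw [e])) with h2 | h4
  · exact absurd (comm_of_two (sq h.1 hs) (sq h.1 ht) (by rw [← h2]; exact pow_orderOf_eq_one _)) hst
  · exact h4

/-- flip of the first coordinate -/
def fs : Equiv.Perm (ℤ × ℤ) := ⟨fun p => (-p.1, p.2), fun p => (-p.1, p.2),
  fun p => by simp, fun p => by simp⟩
/-- swap -/
def ft : Equiv.Perm (ℤ × ℤ) := ⟨fun p => (p.2, p.1), fun p => (p.2, p.1),
  fun p => by simp, fun p => by simp⟩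
/-- affine flip of the second coordinate -/
def fu : Equiv.Perm (ℤ × ℤ) := ⟨fun p => (p.1, 1 - p.2), fun p => (p.1, 1 - p.2),
  fun p => by simp, fun p => by simp⟩

lemma fs_app (p : ℤ × ℤ) : fs p = (-p.1, p.2) := rfl
lemma ft_app (p : ℤ × ℤ) : ft p = (p.2, p.1) := rfl
lemma fu_app (p : ℤ × ℤ) : fu p = (p.1, 1 - p.2) := rfl

lemma pow4 {G : Type} [Group G] {x : G} {n : ℕ} (hn : 4 ∣ n) (hx : x ^ 4 = 1) : x ^ n = 1 := by
  obtain ⟨k, rfl⟩ := hn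
  rw [pow_mul, hx, one_pow]

lemma trip (h : SEv S) {T : Set W} (hT : T ⊆ S) (hfin : Finite (Subgroup.closure T)) {s t u : W}
    (hs : s ∈ T) (ht : t ∈ T) (hu : u ∈ T) (hsu : s ≠ u) (hst : s * t ≠ t * s)
    (htu : t * u ≠ u * t) : False := by
  classical
  have hst' : s ≠ t := fun e => hst (by rw [e])
  have htu' : t ≠ u := fun e => htu (by rw [e])
  have n1 := four_dvd h (hT hs) (hT ht) hst
  have n2 := four_dvd h (hT ht) (hT hs) (Ne.symm hst)
  have n3 := four_dvd h (hT ht) (hT hu) htu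
  have n4 := four_dvd h (hT hu) (hT ht) (Ne.symm htu)
  let f : W → Equiv.Perm (ℤ × ℤ) :=
    fun x => if x = s then fs else if x = t then ft else if x = u then fu else 1
  have f1 : f s = fs := by simp [f]
  have f2 : f t = ft := by simp [f, hst'.symm]
  have f3 : f u = fu := by simp [f, hsu.symm, htu'.symm]
  have f4 : ∀ x, x ≠ s → x ≠ t → x ≠ u → f x = 1 := by
    intro x h1 h2 h3; simp [f, h1, h2, h3]
  have q1 : fs * fs = 1 := by ext p <;> simp [fs_app]
  have q2 : ft * ft = 1 := by ext p <;> simp [ft_app]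
  have q3 : fu * fu = 1 := by ext p <;> simp [fu_app]
  have r1 : (fs * ft) ^ 4 = 1 := by ext p <;> simp [fs_app, ft_app, pow_succ]
  have r2 : (ft * fs) ^ 4 = 1 := by ext p <;> simp [fs_app, ft_app, pow_succ]
  have r3 : (ft * fu) ^ 4 = 1 := by ext p <;> simp [fu_app, ft_app, pow_succ]
  have r4 : (fu * ft) ^ 4 = 1 := by ext p <;> simp [fu_app, ft_app, pow_succ]
  have r5 : (fs * fu) * (fs * fu) = 1 := by ext p <;> simp [fu_app, fs_app]
  have r6 : (fu * fs) * (fu * fs) = 1 := by ext p <;> simp [fu_app, fs_app]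
  have hsq : ∀ x, f x * f x = 1 := by
    intro x
    by_cases h1 : x = s
    · rw [h1, f1, q1]
    by_cases h2 : x = t
    · rw [h2, f2, q2]
    by_cases h3 : x = u
    · rw [h3, f3, q3]
    rw [f4 x h1 h2 h3, one_mul]
  obtain ⟨φ, hφ⟩ := lift' h.1 f (fun x _ => hsq x) (by
    intro x hx y hy hxy
    by_cases o1 : x ≠ s ∧ x ≠ t ∧ x ≠ u
    · apply h.pow_one hx hy hxy
      rw [f4 x o1.1 o1.2.1 o1.2.2, one_mul]; exact hsq y
    by_cases o2 : y ≠ s ∧ y ≠ t ∧ y ≠ u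
    · apply h.pow_one hx hy hxy
      rw [f4 y o2.1 o2.2.1 o2.2.2, mul_one]; exact hsq x
    have c1 : x = s ∨ x = t ∨ x = u := by tauto
    have c2 : y = s ∨ y = t ∨ y = u := by tauto
    rcases c1 with rfl | rfl | rfl <;> rcases c2 with rfl | rfl | rfl
    · exact absurd rfl hxy
    · rw [f1, f2]; exact pow4 n1 r1
    · rw [f1, f3]; exact h.pow_one hx hy hxy r5
    · rw [f1, f2]; exact pow4 n2 r2
    · exact absurd rfl hxy
    · rw [f3, f2]; exact pow4 n3 r3
    · rw [f1, f3]; exact h.pow_one hx hy hxy r6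
    · rw [f3, f2]; exact pow4 n4 r4
    · exact absurd rfl hxy)
  have hmem : s * (t * u * t) ∈ Subgroup.closure T := by
    have := fun x (hx : x ∈ T) => Subgroup.subset_closure hx
    exact mul_mem (this s hs) (mul_mem (mul_mem (this t ht) (this u hu)) (this t ht))
  have hfo : IsOfFinOrder (⟨_, hmem⟩ : Subgroup.closure T) := isOfFinOrder_of_finite _
  obtain ⟨n, hn, hn1⟩ := isOfFinOrder_iff_pow_eq_one.1 hfo
  have hn2 : (s * (t * u * t)) ^ n = 1 := by
    have := congrArg Subtype.val hn1
    simpa using this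
  have hn3 : (fs * (ft * fu * ft)) ^ n = 1 := by
    have := congrArg φ hn2
    rw [map_pow, map_mul, map_mul, map_mul, hφ s (hT hs), hφ t (hT ht), hφ u (hT hu), f1, f2, f3,
      map_one] at this
    exact this
  have key : ∀ n : ℕ, ((fs * (ft * fu * ft)) ^ n) (0, 0) = (-(n : ℤ), 0) := by
    intro n
    induction n with
    | zero => simp
    | succ n ih =>
      rw [pow_succ', Equiv.Perm.mul_apply, ih]
      simp [fs_app, ft_app, fu_app]
      ring
  have := key n
  rw [hn3] at this
  simp at this
  omega

/-- the component of `s` in `T` -/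
def A (T : Set W) (s : W) : Set W := {t | t ∈ T ∧ (t = s ∨ s * t ≠ t * s)}

lemma A_comm (h : SEv S) {T : Set W} (hT : T ⊆ S) (hfin : Finite (Subgroup.closure T)) {s : W}
    (hs : s ∈ T) {a b : W} (ha : a ∈ A T s) (hb : b ∈ T) (hbA : b ∉ A T s) : a * b = b * a := by
  have hbs : b ≠ s := fun e => hbA ⟨hb, Or.inl e⟩
  have hsb : s * b = b * s := by
    by_contra hn; exact hbA ⟨hb, Or.inr hn⟩
  obtain ⟨haT, rfl | ha⟩ := ha
  · exact hsb
  · by_contra hn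
    exact trip h hT hfin hs haT hb hbs.symm ha hn

lemma A_eq (h : SEv S) {T : Set W} (hT : T ⊆ S) (hfin : Finite (Subgroup.closure T)) {s : W}
    (hs : s ∈ T) : ∃ t ∈ T, A T s = {s, t} ∧ (t = s ∨ s * t ≠ t * s) := by
  by_cases hc : ∃ t ∈ T, s * t ≠ t * s
  · obtain ⟨t, ht, hst⟩ := hc
    refine ⟨t, ht, ?_, Or.inr hst⟩
    ext x
    constructor
    · rintro ⟨hx, rfl | hx'⟩
      · exact Or.inl rfl
      · right
        by_contra hne
        exact trip h hT hfin ht hs hx (Ne.symm hne) (Ne.symm hst) hx'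
    · rintro (rfl | hx)
      · exact ⟨hs, Or.inl rfl⟩
      · rw [Set.mem_singleton_iff] at hx
        subst hx
        exact ⟨ht, Or.inr hst⟩
  · push Not at hc
    refine ⟨s, hs, ?_, Or.inl rfl⟩
    ext x
    constructor
    · rintro ⟨hx, rfl | hx'⟩
      · exact Or.inl rfl
      · exact absurd (hc x hx) hx'
    · rintro (rfl | rfl)
      · exact ⟨hs, Or.inl rfl⟩
      · exact ⟨hs, Or.inl rfl⟩

/-- decomposition of an element -/
lemma dec (h : SEv S) {T : Set W} (hT : T ⊆ S) (hfin : Finite (Subgroup.closure T)) {s : W}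
    (hs : s ∈ T) {w : W} (hw : w ∈ Subgroup.closure T) :
    ∃ y, w = q h (A T s) w * y ∧ ∀ x ∈ Subgroup.closure (A T s), x * y = y * x := by
  have hc : ∀ a ∈ A T s, ∀ b ∈ T \ A T s, a * b = b * a :=
    fun a ha b hb => A_comm h hT hfin hs ha hb.1 hb.2
  refine ⟨q h (T \ A T s) w, ?_, fun x hx => clo_comm hc hx (q_range h _ w)⟩
  rw [← q_union h (fun a ha hb => hb.2 ha) hc]
  have : A T s ∪ T \ A T s = T := Set.union_sdiff_cancel (fun x hx => hx.1)
  rw [this, q_fix h hT subset_rfl hw]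

lemma loc (h : SEv S) {T : Set W} (hT : T ⊆ S) (hfin : Finite (Subgroup.closure T))
    (N : Subgroup W) {w : W} (hw : w ∈ Subgroup.closure T) (hN : ∀ s ∈ T, q h (A T s) w ∈ N) :
    w ∈ N := by
  have hTf : T.Finite := h.1.1.subset hT
  have key : ∀ n : ℕ, ∀ U ⊆ T, U.ncard = n → (∀ r ∈ U, A T r ⊆ U) → q h U w ∈ N := by
    intro n
    induction n using Nat.strong_induction_on with
    | _ n ih =>
    intro U hU hn hcl
    by_cases hne : U.Nonempty
    · obtain ⟨s, hs⟩ := hne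
      have hAU := hcl s hs
      have hc : ∀ a ∈ A T s, ∀ b ∈ U \ A T s, a * b = b * a :=
        fun a ha b hb => A_comm h hT hfin (hU hs) ha (hU hb.1) hb.2
      have : U = A T s ∪ U \ A T s := (Set.union_sdiff_cancel hAU).symm
      rw [this, q_union h (fun a ha hb => hb.2 ha) hc]
      refine mul_mem (hN s (hU hs)) (ih _ ?_ _ ?_ rfl ?_)
      · rw [← hn]
        apply Set.ncard_lt_ncard _ (hTf.subset hU)
        refine ⟨Set.sdiff_subset, fun hsub => (hsub hs).2 ⟨hU hs, Or.inl rfl⟩⟩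
      · exact Set.sdiff_subset.trans hU
      · intro r hr t ht
        refine ⟨hcl r hr.1 ht, fun htA => ?_⟩
        rcases ht.2 with e | e
        · exact hr.2 (e ▸ htA)
        · exact e (hc t htA r hr).symm
    · rw [Set.not_nonempty_iff_eq_empty] at hne
      have : q h U w ∈ Subgroup.closure (∅ : Set W) := by rw [hne]; exact q_range h _ w
      rw [Subgroup.closure_empty, Subgroup.mem_bot] at this
      rw [this]; exact one_mem _
  have := key _ T subset_rfl rfl (fun r _ x hx => hx.1)
  rwa [q_fix h hT subset_rfl hw] at this

section dihedral
variable {s t : W}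

lemma rot_conj (hs : s * s = 1) (ht : t * t = 1) (j : ℤ) : s * (s * t) ^ j * s = (s * t) ^ (-j) := by
  have hs' : s⁻¹ = s := inv_eq_of_mul_eq_one_left hs
  have ht' : t⁻¹ = t := inv_eq_of_mul_eq_one_left ht
  have h1 : s * (s * t) * s⁻¹ = (s * t)⁻¹ := by
    rw [mul_inv_rev, hs', ht', ← mul_assoc, hs, one_mul]
  calc s * (s * t) ^ j * s = s * (s * t) ^ j * s⁻¹ := by rw [hs']
    _ = (s * (s * t) * s⁻¹) ^ j := by rw [conj_zpow]
    _ = (s * t) ^ (-j) := by rw [h1, inv_zpow, zpow_neg]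

lemma rot_s (hs : s * s = 1) (ht : t * t = 1) (j : ℤ) : (s * t) ^ j * s = s * (s * t) ^ (-j) := by
  rw [← rot_conj hs ht j, ← mul_assoc, ← mul_assoc, hs, one_mul]

lemma dih (hs : s * s = 1) (ht : t * t = 1) {x : W} (hx : x ∈ Subgroup.closure {s, t}) :
    ∃ j : ℤ, x = (s * t) ^ j ∨ x = s * (s * t) ^ j := by
  induction hx using Subgroup.closure_induction with
  | mem x hx =>
    rcases hx with rfl | hx
    · exact ⟨0, Or.inr (by simp)⟩
    · rw [Set.mem_singleton_iff] at hx
      subst hx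
      exact ⟨1, Or.inr (by rw [zpow_one, ← mul_assoc, hs, one_mul])⟩
  | one => exact ⟨0, Or.inl (by simp)⟩
  | mul x y _ _ hx hy =>
    obtain ⟨i, rfl | rfl⟩ := hx <;> obtain ⟨j, rfl | rfl⟩ := hy
    · exact ⟨i + j, Or.inl (by rw [zpow_add])⟩
    · exact ⟨-i + j, Or.inr (by rw [← mul_assoc, rot_s hs ht, mul_assoc, zpow_add])⟩
    · exact ⟨i + j, Or.inr (by rw [mul_assoc, zpow_add])⟩
    · exact ⟨-i + j, Or.inl (by
        rw [mul_assoc, ← mul_assoc _ s, rot_s hs ht, mul_assoc s, ← mul_assoc s, hs, one_mul,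
          zpow_add])⟩
  | inv x _ hx =>
    obtain ⟨i, rfl | rfl⟩ := hx
    · exact ⟨-i, Or.inl (by rw [zpow_neg])⟩
    · exact ⟨i, Or.inr (by
        rw [mul_inv_rev, inv_eq_of_mul_eq_one_left hs, ← zpow_neg, rot_s hs ht, neg_neg])⟩

lemma dih_finite (hs : s * s = 1) (ht : t * t = 1) (h0 : orderOf (s * t) ≠ 0) :
    Finite (Subgroup.closure {s, t}) := by
  have hf : (Set.range fun j : ℤ => (s * t) ^ j).Finite := by
    have : IsOfFinOrder (s * t) := orderOf_ne_zero_iff.1 h0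
    exact finite_zpowers.2 this
  have : ((Subgroup.closure {s, t} : Subgroup W) : Set W).Finite := by
    refine (hf.union (hf.image (fun x => s * x))).subset ?_
    intro x hx
    obtain ⟨j, rfl | rfl⟩ := dih hs ht hx
    · exact Or.inl ⟨j, rfl⟩
    · exact Or.inr ⟨_, ⟨j, rfl⟩, rfl⟩
  exact this

/-- commutators with `s` are even rotations -/
lemma dih_comm (hs : s * s = 1) (ht : t * t = 1) {x : W} (hx : x ∈ Subgroup.closure {s, t}) :
    ∃ j : ℤ, s * x * s⁻¹ * x⁻¹ = (s * t) ^ (2 * j) := by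
  have hs' : s⁻¹ = s := inv_eq_of_mul_eq_one_left hs
  obtain ⟨j, rfl | rfl⟩ := dih hs ht hx
  · refine ⟨-j, ?_⟩
    rw [hs', rot_conj hs ht, ← zpow_neg, ← zpow_add]; congr 1; ring
  · refine ⟨j, ?_⟩
    rw [mul_inv_rev, hs', ← mul_assoc s s, hs, one_mul, mul_assoc, ← mul_assoc s, ← zpow_neg,
      rot_conj hs ht, ← zpow_add, neg_neg]
    congr 1; ring

/-- a reflection inverts rotations -/
lemma refl_rot (hs : s * s = 1) (ht : t * t = 1) (i j : ℤ) :
    (s * (s * t) ^ i) * (s * t) ^ j * (s * (s * t) ^ i)⁻¹ = (s * t) ^ (-j) := by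
  have hs' : s⁻¹ = s := inv_eq_of_mul_eq_one_left hs
  rw [mul_inv_rev, hs', ← zpow_neg, mul_assoc s, ← zpow_add, mul_assoc, ← mul_assoc _ _ s,
    ← zpow_add, ← mul_assoc, rot_conj hs ht]
  congr 1; ring

end dihedral

section char
variable {s t : W}

lemma chi_rot (h : SEv S) (hs : s ∈ S) (ht : t ∈ S) (hst : s ≠ t) (j : ℤ) :
    chi h s ((s * t) ^ j) = (-1) ^ j ∧ chi h t ((s * t) ^ j) = (-1) ^ j ∧
    chi h s (s * (s * t) ^ j) = -(-1) ^ j ∧ chi h t (s * (s * t) ^ j) = (-1) ^ j := by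
  simp [map_zpow, map_mul, chi_self h hs, chi_self h ht, chi_ne h hs hst, chi_ne h ht hst.symm]

lemma m1_even {j : ℤ} (h : Even j) : (-1 : ℤˣ) ^ j = 1 := Even.neg_one_zpow h
lemma m1_odd {j : ℤ} (h : ¬ Even j) : (-1 : ℤˣ) ^ j = -1 := by
  rw [Int.not_even_iff_odd] at h
  exact Odd.neg_one_zpow h

/-- (A) an involution is not both `s`-odd and `t`-odd -/
lemma factA (h : SEv S) (hs : s ∈ S) (ht : t ∈ S) (hst : s * t ≠ t * s) {x : W}
    (hx : x ∈ Subgroup.closure {s, t}) (hx2 : x * x = 1) (h1 : chi h s x = -1)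
    (h2 : chi h t x = -1) : False := by
  have hne : s ≠ t := fun e => hst (by rw [e])
  have h4 := four_dvd h hs ht hst
  obtain ⟨j, rfl | rfl⟩ := dih (sq h.1 hs) (sq h.1 ht) hx
  · obtain ⟨c1, c2, -, -⟩ := chi_rot h hs ht hne j
    rw [← zpow_add] at hx2
    have := orderOf_dvd_iff_zpow_eq_one.2 hx2
    have h4' : (4 : ℤ) ∣ j + j := (Int.natCast_dvd_natCast.2 h4).trans this
    have he : Even j := by rw [even_iff_two_dvd]; omega
    rw [c1, m1_even he] at h1
    exact absurd h1 (by decide)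
  · obtain ⟨-, -, c1, c2⟩ := chi_rot h hs ht hne j
    rw [c1] at h1
    rw [c2] at h2
    rw [h2] at h1
    exact absurd h1 (by decide)

/-- (B) an even involution is a rotation with trivial square -/
lemma factB (h : SEv S) (hs : s ∈ S) (ht : t ∈ S) (hst : s ≠ t) {x : W}
    (hx : x ∈ Subgroup.closure {s, t}) (h1 : chi h s x = 1)
    (h2 : chi h t x = 1) : ∃ j : ℤ, x = (s * t) ^ j := by
  obtain ⟨j, rfl | rfl⟩ := dih (sq h.1 hs) (sq h.1 ht) hx
  · exact ⟨j, rfl⟩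
  · obtain ⟨-, -, c1, c2⟩ := chi_rot h hs ht hst j
    rw [c1] at h1
    rw [c2] at h2
    rw [h2] at h1
    exact absurd h1 (by decide)

/-- (C) odd in exactly one variable means reflection -/
lemma factC (h : SEv S) (hs : s ∈ S) (ht : t ∈ S) (hst : s ≠ t) {x : W}
    (hx : x ∈ Subgroup.closure {s, t}) (h1 : chi h s x ≠ chi h t x) :
    ∃ j : ℤ, x = s * (s * t) ^ j := by
  obtain ⟨j, rfl | rfl⟩ := dih (sq h.1 hs) (sq h.1 ht) hx
  · obtain ⟨c1, c2, -, -⟩ := chi_rot h hs ht hst j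
    rw [c1, c2] at h1
    exact absurd rfl h1
  · exact ⟨j, rfl⟩

end char

end SE

namespace SE

variable {W : Type} [Group W] {S S' : Set W}

/-- invariant subgroup attached to a (maximal finite) subgroup `G` and `e` -/
def K (G : Subgroup W) (e : ℕ) : Subgroup W :=
  Subgroup.closure {a | a ∈ G ∧ a * a = 1 ∧ ∀ b ∈ G, (a * b * a⁻¹ * b⁻¹) ^ e = 1} ⊔ commutator W

lemma conj_comm (g : W) (a b : W) (e : ℕ) : (g * a * g⁻¹ * b * (g * a * g⁻¹)⁻¹ * b⁻¹) ^ e =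
    g * (a * (g⁻¹ * b * g) * a⁻¹ * (g⁻¹ * b * g)⁻¹) ^ e * g⁻¹ := by
  rw [← conj_pow]; congr 1; group

lemma mem_of_conj {N : Subgroup W} (hc : commutator W ≤ N) {g s : W} (h : g * s * g⁻¹ ∈ N) :
    s ∈ N := by
  have h1 : g * s⁻¹ * g⁻¹ * s⁻¹⁻¹ ∈ commutator W := by
    have := Subgroup.commutator_mem_commutator (Subgroup.mem_top g) (Subgroup.mem_top s⁻¹)
    simpa [commutatorElement_def, commutator_def] using this
  have h2 := mul_mem h (hc h1)
  have : g * s * g⁻¹ * (g * s⁻¹ * g⁻¹ * s⁻¹⁻¹) = s := by group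
  rwa [this] at h2

lemma K_good (h : SEv S) {G : Subgroup W} {g : W} {T : Set W} (hT : T ⊆ S)
    (hfin : Finite (Subgroup.closure T)) (hG : ∀ x, x ∈ G ↔ g⁻¹ * x * g ∈ Subgroup.closure T)
    (e : ℕ) : Good S (K G e) ∧
      ∀ s ∈ S, s ∈ K G e ↔ s ∈ {s | s ∈ T ∧ ∀ t ∈ T, (s * t) ^ (2 * e) = 1} := by
  have hc : commutator W ≤ K G e := le_sup_right
  refine good_of h hc ?_ ?_
  · rintro s ⟨hs, hst⟩
    have hs2 := sq h.1 (hT hs)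
    apply mem_of_conj (g := g) hc
    apply (le_sup_left : _ ≤ K G e)
    apply Subgroup.subset_closure
    refine ⟨?_, ?_, ?_⟩
    · rw [hG]
      have : g⁻¹ * (g * s * g⁻¹) * g = s := by group
      rw [this]; exact Subgroup.subset_closure hs
    · have : g * s * g⁻¹ * (g * s * g⁻¹) = g * (s * s) * g⁻¹ := by group
      rw [this, hs2]; group
    · intro b hb
      rw [hG] at hb
      rw [conj_comm]
      obtain ⟨y, hy1, hy2⟩ := dec h hT hfin hs hb
      obtain ⟨t, ht, hA, -⟩ := A_eq h hT hfin hs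
      have hx := q_range h (A T s) (g⁻¹ * b * g)
      set x := q h (A T s) (g⁻¹ * b * g) with hxdef
      rw [hA] at hx hy2
      have hsy : s * y = y * s := hy2 s (Subgroup.subset_closure (by simp))
      obtain ⟨j, hj⟩ := dih_comm hs2 (sq h.1 (hT ht)) hx
      have e1 : s * (g⁻¹ * b * g) * s⁻¹ * (g⁻¹ * b * g)⁻¹ = s * x * s⁻¹ * x⁻¹ := by
        rw [hy1]
        calc s * (x * y) * s⁻¹ * (x * y)⁻¹ = s * x * (y * s⁻¹) * y⁻¹ * x⁻¹ := by group
          _ = s * x * (s⁻¹ * (s * y) * s⁻¹) * y⁻¹ * x⁻¹ := by group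
          _ = s * x * (s⁻¹ * (y * s) * s⁻¹) * y⁻¹ * x⁻¹ := by rw [hsy]
          _ = s * x * s⁻¹ * x⁻¹ := by group
      rw [e1, hj, ← zpow_natCast, ← zpow_mul]
      have e2 : (2 * j * (e : ℤ)) = ((2 * e : ℕ) : ℤ) * j := by push_cast; ring
      rw [e2, zpow_mul, zpow_natCast, hst t ht]
      simp
  · intro w hw s hs hsV
    have hle : K G e ≤ (chi h s).ker := by
      refine sup_le ?_ (Abelianization.commutator_subset_ker _)
      rw [Subgroup.closure_le]
      rintro a ⟨ha, ha2, hab⟩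
      rw [SetLike.mem_coe, MonoidHom.mem_ker]
      rw [hG] at ha
      rw [← chi_conj' h s g a]
      by_cases hsT : s ∈ T
      · by_contra hne
        have hchi : chi h s (g⁻¹ * a * g) = -1 := (chi_or h s _).resolve_left hne
        have : ∃ t ∈ T, (s * t) ^ (2 * e) ≠ 1 := by
          by_contra hcon
          push Not at hcon
          exact hsV ⟨hsT, hcon⟩
        obtain ⟨t, ht, hst⟩ := this
        have hs2 := sq h.1 hs
        have ht2 := sq h.1 (hT ht)
        have hnc : s * t ≠ t * s := by
          intro hcm
          rw [pow_mul, two_of_comm hs2 ht2 hcm, one_pow] at hst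
          exact hst rfl
        have hne' : s ≠ t := fun e => hnc (by rw [e])
        have hx := q_range h {s, t} (g⁻¹ * a * g)
        set a' := g⁻¹ * a * g with ha'
        have hx2 : q h {s, t} a' * q h {s, t} a' = 1 := by
          rw [← map_mul]
          have : a' * a' = g⁻¹ * (a * a) * g := by rw [ha']; group
          rw [this, ha2]; simp
        have c1 : chi h s (q h {s, t} a') = -1 := by rw [chi_q h (by simp), hchi]
        have c2 : chi h t (q h {s, t} a') = 1 :=
          (chi_or h t _).resolve_right fun c2 => factA h hs (hT ht) hnc hx hx2 c1 c2
        obtain ⟨j, hj⟩ := factC h hs (hT ht) hne' hx (by rw [c1, c2]; decide)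
        have hb := hab (g * (s * t) * g⁻¹) (by
          rw [hG]
          have : g⁻¹ * (g * (s * t) * g⁻¹) * g = s * t := by group
          rw [this]
          exact mul_mem (Subgroup.subset_closure hsT) (Subgroup.subset_closure ht))
        have hb' : (a' * (s * t) * a'⁻¹ * (s * t)⁻¹) ^ e = 1 := by
          have : a * (g * (s * t) * g⁻¹) * a⁻¹ * (g * (s * t) * g⁻¹)⁻¹ =
            g * (a' * (s * t) * a'⁻¹ * (s * t)⁻¹) * g⁻¹ := by rw [ha']; group
          rw [this, conj_pow] at hb
          rwa [conj_eq_one_iff] at hb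
        clear_value a'
        have hb2 := congrArg (q h {s, t}) hb'
        have qs : q h {s, t} s = s := q_mem h hs (by simp)
        have qt : q h {s, t} t = t := q_mem h (hT ht) (by simp)
        rw [map_pow, map_mul, map_mul, map_mul, map_inv, map_inv, map_mul, qs, qt, map_one, hj] at hb2
        have hr := refl_rot hs2 ht2 j 1
        rw [zpow_one] at hr
        rw [hr, zpow_neg, zpow_one, ← mul_inv_rev, inv_pow, inv_eq_one, ← pow_two, ← pow_mul] at hb2
        exact hst hb2
      · exact chi_clo h hT hsT ha
    exact hle hw

/-- maximal elementary abelian 2-subgroups -/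
def IsME (E : Subgroup W) : Prop := (Finite E ∧ ∀ a ∈ E, a * a = 1) ∧
  ∀ K : Subgroup W, (Finite K ∧ ∀ a ∈ K, a * a = 1) → E ≤ K → K = E

lemma el_comm {E : Subgroup W} (hE : ∀ a ∈ E, a * a = 1) {a b : W} (ha : a ∈ E) (hb : b ∈ E) :
    a * b = b * a :=
  comm_of_two (hE a ha) (hE b hb) (by rw [pow_two]; exact hE _ (mul_mem ha hb))

lemma ME_mem {E : Subgroup W} (hE : IsME E) {y : W} (hy : y * y = 1)
    (hc : ∀ a ∈ E, a * y = y * a) : y ∈ E := by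
  have hE2 := hE.1.2
  let K : Subgroup W :=
    { carrier := {z | ∃ a ∈ E, z = a ∨ z = a * y}
      one_mem' := ⟨1, one_mem _, Or.inl rfl⟩
      mul_mem' := by
        rintro _ _ ⟨a, ha, rfl | rfl⟩ ⟨b, hb, rfl | rfl⟩
        · exact ⟨_, mul_mem ha hb, Or.inl rfl⟩
        · exact ⟨_, mul_mem ha hb, Or.inr (by rw [mul_assoc])⟩
        · exact ⟨_, mul_mem ha hb, Or.inr (by rw [mul_assoc, ← hc _ hb, mul_assoc])⟩
        · exact ⟨_, mul_mem ha hb, Or.inl (by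
            rw [mul_assoc, ← mul_assoc y, ← hc b hb, mul_assoc b, hy, mul_one])⟩
      inv_mem' := by
        rintro _ ⟨a, ha, rfl | rfl⟩
        · exact ⟨_, inv_mem ha, Or.inl rfl⟩
        · exact ⟨_, inv_mem ha, Or.inr (by
            rw [mul_inv_rev, hc _ (inv_mem ha), inv_eq_of_mul_eq_one_left hy])⟩ }
  have hK : ∀ z, z ∈ K ↔ ∃ a ∈ E, z = a ∨ z = a * y := fun z => Iff.rfl
  have hKf : Finite K := by
    have hEf : (E : Set W).Finite := hE.1.1
    have : (K : Set W).Finite := by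
      refine (hEf.union (hEf.image (fun x => x * y))).subset ?_
      rintro z hz
      obtain ⟨a, ha, rfl | rfl⟩ := (hK z).1 hz
      · exact Or.inl ha
      · exact Or.inr ⟨a, ha, rfl⟩
    exact this
  have := hE.2 K ⟨hKf, ?_⟩ ?_
  · rw [← this]; exact (hK y).2 ⟨1, one_mem _, Or.inr (by simp)⟩
  · intro z hz
    obtain ⟨a, ha, rfl | rfl⟩ := (hK z).1 hz
    · exact hE2 _ ha
    · rw [mul_assoc, ← mul_assoc y, ← hc a ha, mul_assoc a, hy, mul_one, hE2 a ha]
  · intro z hz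
    exact (hK z).2 ⟨z, hz, Or.inl rfl⟩

lemma E_good (h : SEv S) {E : Subgroup W} (hE : IsME E) : Good S (E ⊔ commutator W) ∧
    ∀ s ∈ S, ∀ t ∈ S, s ∈ E ⊔ commutator W → t ∈ E ⊔ commutator W → s * t = t * s := by
  have hE2 := hE.1.2
  have : Finite E := hE.1.1
  obtain ⟨g, T, hT, hfin, hg⟩ := tits' h.1 E
  have hc : commutator W ≤ E ⊔ commutator W := le_sup_right
  have hsT : ∀ s a, a ∈ E → chi h s a = -1 → s ∈ T := by
    intro s a ha hs
    by_contra hn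
    have := chi_clo h hT hn (hg a ha)
    rw [chi_conj', hs] at this
    exact absurd this (by decide)
  have hsq : ∀ (f : W →* W) (a : W), a ∈ E → f (g⁻¹ * a * g) * f (g⁻¹ * a * g) = 1 := by
    intro f a ha
    rw [← map_mul]
    have : g⁻¹ * a * g * (g⁻¹ * a * g) = g⁻¹ * (a * a) * g := by group
    rw [this, hE2 a ha]; simp
  have main := good_of h (N := E ⊔ commutator W)
    (V := {s | s ∈ S ∧ ∃ a ∈ E, chi h s a = -1}) hc ?_ ?_
  · refine ⟨main.1, fun s hs t ht hsE htE => ?_⟩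
    obtain ⟨-, a, ha, hsa⟩ := (main.2 s hs).1 hsE
    obtain ⟨-, b, hb, htb⟩ := (main.2 t ht).1 htE
    by_contra hnc
    have qa := q_range h {s, t} (g⁻¹ * a * g)
    have qb := q_range h {s, t} (g⁻¹ * b * g)
    have c1 : chi h s (q h {s, t} (g⁻¹ * a * g)) = -1 := by
      rw [chi_q h (by simp), chi_conj', hsa]
    have c2 : chi h t (q h {s, t} (g⁻¹ * b * g)) = -1 := by
      rw [chi_q h (by simp), chi_conj', htb]
    have c3 : chi h t (q h {s, t} (g⁻¹ * a * g)) = 1 :=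
      (chi_or h t _).resolve_right fun c3 => factA h hs ht hnc qa (hsq _ a ha) c1 c3
    have c4 : chi h s (q h {s, t} (g⁻¹ * b * g)) = 1 :=
      (chi_or h s _).resolve_right fun c4 => factA h hs ht hnc qb (hsq _ b hb) c4 c2
    have e1 : q h {s, t} (g⁻¹ * (a * b) * g) =
        q h {s, t} (g⁻¹ * a * g) * q h {s, t} (g⁻¹ * b * g) := by
      rw [← map_mul]; congr 1; group
    refine factA h hs ht hnc (q_range h {s, t} (g⁻¹ * (a * b) * g)) (hsq _ _ (mul_mem ha hb)) ?_ ?_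
    · rw [e1, map_mul, c1, c4, mul_one]
    · rw [e1, map_mul, c2, c3, one_mul]
  · rintro s ⟨hs, a, ha, hsa⟩
    have hsT' := hsT s a ha hsa
    obtain ⟨t, ht, hA, hts⟩ := A_eq h hT hfin hsT'
    have hx := q_range h (A T s) (g⁻¹ * a * g)
    set x := q h (A T s) (g⁻¹ * a * g) with hxd
    have hx2 : x * x = 1 := hsq _ a ha
    have cs : chi h s x = -1 := by
      rw [hxd, chi_q h (by rw [hA]; simp), chi_conj', hsa]
    have cr : ∀ r ∈ S, r ≠ s → chi h r x = 1 := by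
      intro r hr hrs
      by_cases hrt : r = t
      · subst hrt
        refine (chi_or h r _).resolve_right fun c2 => ?_
        rw [hA] at hx
        exact factA h hs hr (hts.resolve_left hrs) hx hx2 cs c2
      · apply chi_clo h _ _ hx
        · exact fun y hy => hT hy.1
        · rw [hA]; simp [hrs, hrt]
    have hxs : x * s ∈ commutator W := by
      apply P_le h le_rfl
      intro r hr _
      rw [map_mul]
      by_cases hrs : r = s
      · subst hrs; rw [cs, chi_self h hr]; decide
      · rw [cr r hr hrs, chi_ne h hs (Ne.symm hrs), mul_one]
    have hy : g * x * g⁻¹ ∈ E := by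
      apply ME_mem hE
      · have : g * x * g⁻¹ * (g * x * g⁻¹) = g * (x * x) * g⁻¹ := by group
        rw [this, hx2]; group
      · intro b hb
        obtain ⟨y, hy1, hy2⟩ := dec h hT hfin hsT' (hg b hb)
        have e1 : q h (A T s) (g⁻¹ * b * g) * x = x * q h (A T s) (g⁻¹ * b * g) := by
          rw [hxd, ← map_mul, ← map_mul]
          congr 1
          have := el_comm hE2 ha hb
          calc g⁻¹ * b * g * (g⁻¹ * a * g) = g⁻¹ * (b * a) * g := by group
            _ = g⁻¹ * (a * b) * g := by rw [this]
            _ = _ := by group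
        have e2 : (g⁻¹ * b * g) * x = x * (g⁻¹ * b * g) := by
          rw [hy1, mul_assoc, ← hy2 x hx, ← mul_assoc, e1, mul_assoc]
        calc b * (g * x * g⁻¹) = g * ((g⁻¹ * b * g) * x) * g⁻¹ := by group
          _ = g * (x * (g⁻¹ * b * g)) * g⁻¹ := by rw [e2]
          _ = _ := by group
    have hxE : x ∈ E ⊔ commutator W := mem_of_conj hc ((le_sup_left : E ≤ _) hy)
    have := mul_mem (inv_mem hxE) (hc hxs)
    rwa [inv_mul_cancel_left] at this
  · intro w hw s hs hsV
    have hle : E ⊔ commutator W ≤ (chi h s).ker := by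
      refine sup_le ?_ (Abelianization.commutator_subset_ker _)
      intro a ha
      rw [MonoidHom.mem_ker]
      exact (chi_or h s a).resolve_right fun c => hsV ⟨hs, a, ha, c⟩
    exact hle hw

/-- commuting pairs match up -/
lemma comm_match (h : SEv S) (h' : SEv S') {s t s' t' : W} (hs : s ∈ S) (ht : t ∈ S)
    (hs' : s' ∈ S') (ht' : t' ∈ S')
    (m1 : ∀ N : Subgroup W, Good S N → Good S' N → (s ∈ N → s' ∈ N))
    (m2 : ∀ N : Subgroup W, Good S N → Good S' N → (t ∈ N → t' ∈ N))
    (hst : s * t = t * s) : s' * t' = t' * s' := by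
  have hs2 := sq h.1 hs
  have ht2 := sq h.1 ht
  have hel : ∀ a ∈ Subgroup.closure ({s, t} : Set W), a * a = 1 := by
    intro a ha
    have h2 := two_of_comm hs2 ht2 hst
    have h3 : ∀ j : ℤ, (s * t) ^ j * (s * t) ^ j = 1 := by
      intro j
      rw [← zpow_add, ← two_mul, zpow_mul]
      rw [show ((s * t) ^ (2 : ℤ)) = 1 from by exact_mod_cast h2, one_zpow]
    obtain ⟨j, rfl | rfl⟩ := dih hs2 ht2 ha
    · exact h3 j
    · rw [← mul_assoc, rot_conj hs2 ht2, ← zpow_add]; simp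
  have hfin : Finite (Subgroup.closure ({s, t} : Set W)) := by
    apply dih_finite hs2 ht2
    have : orderOf (s * t) ∣ 2 := orderOf_dvd_of_pow_eq_one (two_of_comm hs2 ht2 hst)
    intro h0
    rw [h0] at this
    exact absurd this (by decide)
  obtain ⟨E, h1, h2, h3⟩ := exists_max h.1 (fun K => Finite K ∧ ∀ a ∈ K, a * a = 1)
    (fun _ h => h.1) _ ⟨hfin, hel⟩
  have hE : IsME E := ⟨h2, h3⟩
  have g1 := E_good h hE
  have g2 := E_good h' hE
  have hle : E ≤ E ⊔ commutator W := le_sup_left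
  refine g2.2 s' hs' t' ht' ?_ ?_
  · exact m1 _ g1.1 g2.1 (hle (h1 (Subgroup.subset_closure (by simp))))
  · exact m2 _ g1.1 g2.1 (hle (h1 (Subgroup.subset_closure (by simp))))

/-- membership in `K` for a noncommuting pair -/
lemma K_pair (h : SEv S) {T : Set W} (hT : T ⊆ S) (hfin : Finite (Subgroup.closure T)) {s t : W}
    (hs : s ∈ T) (ht : t ∈ T) (hst : s * t ≠ t * s) (e : ℕ) :
    (s ∈ {s | s ∈ T ∧ ∀ t ∈ T, (s * t) ^ (2 * e) = 1}) ↔ orderOf (s * t) ∣ 2 * e := by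
  constructor
  · rintro ⟨-, h2⟩
    exact orderOf_dvd_of_pow_eq_one (h2 t ht)
  · intro hd
    refine ⟨hs, fun r hr => ?_⟩
    by_cases hrt : r = t
    · subst hrt; exact orderOf_dvd_iff_pow_eq_one.1 hd
    · have : s * r = r * s := by
        by_contra hn
        exact trip h hT hfin ht hs hr (Ne.symm hrt) (Ne.symm hst) hn
      rw [pow_mul, two_of_comm (sq h.1 (hT hs)) (sq h.1 (hT hr)) this, one_pow]

/-- finite noncommuting pairs match up -/
lemma fin_match (h : SEv S) (h' : SEv S') {s t s' t' : W} (hs : s ∈ S) (ht : t ∈ S)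
    (hs' : s' ∈ S') (ht' : t' ∈ S')
    (m1 : ∀ N : Subgroup W, Good S N → Good S' N → (s ∈ N ↔ s' ∈ N))
    (m2 : ∀ N : Subgroup W, Good S N → Good S' N → (t ∈ N ↔ t' ∈ N))
    (hst : s * t ≠ t * s) (hst' : s' * t' ≠ t' * s') (h0 : orderOf (s * t) ≠ 0) :
    orderOf (s * t) = orderOf (s' * t') := by
  have hs2 := sq h.1 hs
  have ht2 := sq h.1 ht
  obtain ⟨G, hG, hmf⟩ := exists_mf h.1 _ (dih_finite hs2 ht2 h0)
  obtain ⟨g, T, hT, hfin, hgG⟩ := mf_eq h.1 hmf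
  obtain ⟨g', T', hT', hfin', hgG'⟩ := mf_eq h'.1 hmf
  have k1 := K_good h hT hfin hgG
  have k2 := K_good h' hT' hfin' hgG'
  have hK0 : ∀ x ∈ G, x * x = 1 → x ∈ K G 0 := by
    intro x hx hx2
    apply (le_sup_left : _ ≤ K G 0)
    exact Subgroup.subset_closure ⟨hx, hx2, fun b _ => by simp⟩
  have sK : s ∈ K G 0 := hK0 s (hG (Subgroup.subset_closure (by simp))) hs2
  have tK : t ∈ K G 0 := hK0 t (hG (Subgroup.subset_closure (by simp))) ht2
  have sT := (((k1 0).2 s hs).1 sK).1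
  have tT := (((k1 0).2 t ht).1 tK).1
  have sT' := (((k2 0).2 s' hs').1 ((m1 _ (k1 0).1 (k2 0).1).1 sK)).1
  have tT' := (((k2 0).2 t' ht').1 ((m2 _ (k1 0).1 (k2 0).1).1 tK)).1
  have key : ∀ e, orderOf (s * t) ∣ 2 * e ↔ orderOf (s' * t') ∣ 2 * e := by
    intro e
    rw [← K_pair h hT hfin sT tT hst, ← K_pair h' hT' hfin' sT' tT' hst', ← (k1 e).2 s hs,
      ← (k2 e).2 s' hs']
    exact m1 _ (k1 e).1 (k2 e).1
  obtain ⟨a, ha⟩ := four_dvd h hs ht hst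
  obtain ⟨b, hb⟩ := four_dvd h' hs' ht' hst'
  apply Nat.dvd_antisymm
  · have := (key (2 * b)).2 ⟨1, by omega⟩
    rwa [show 2 * (2 * b) = orderOf (s' * t') by omega] at this
  · have := (key (2 * a)).1 ⟨1, by omega⟩
    rwa [show 2 * (2 * a) = orderOf (s * t) by omega] at this

lemma order_two (h : SEv S) {s t : W} (hs : s ∈ S) (ht : t ∈ S) (hst : s ≠ t)
    (hc : s * t = t * s) : orderOf (s * t) = 2 := by
  rcases h.2 s hs t ht hst with h2 | h4
  · exact h2
  · have : orderOf (s * t) ∣ 2 :=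
      orderOf_dvd_of_pow_eq_one (two_of_comm (sq h.1 hs) (sq h.1 ht) hc)
    have := h4.trans this
    exact absurd this (by decide)

theorem rigid_both (h : SEv S) (h' : SEv S') : ∃ ψ : S ≃ S', ∀ s t : S,
    orderOf ((s : W) * (t : W)) = orderOf ((ψ s : W) * (ψ t : W)) := by
  obtain ⟨ψ, hψ⟩ := matching h h'
  refine ⟨ψ, fun s t => ?_⟩
  by_cases hst : s = t
  · subst hst
    rw [sq h.1 s.2, sq h'.1 (ψ s).2]
  have hst1 : (s : W) ≠ t := fun e => hst (Subtype.ext e)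
  have hst2 : (ψ s : W) ≠ ψ t := fun e => hst (ψ.injective (Subtype.ext e))
  have m := fun s N h1 h2 => hψ N h1 h2 s
  by_cases hc : (s : W) * t = t * s
  · rw [order_two h s.2 t.2 hst1 hc, order_two h' (ψ s).2 (ψ t).2 hst2
      (comm_match h h' s.2 t.2 (ψ s).2 (ψ t).2 (fun N a b => (m s N a b).1)
        (fun N a b => (m t N a b).1) hc)]
  · have hc' : (ψ s : W) * ψ t ≠ ψ t * ψ s := fun e => hc
      (comm_match h' h (ψ s).2 (ψ t).2 s.2 t.2 (fun N a b => (m s N b a).2)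
        (fun N a b => (m t N b a).2) e)
    by_cases h0 : orderOf ((s : W) * t) = 0
    · by_cases h0' : orderOf ((ψ s : W) * ψ t) = 0
      · rw [h0, h0']
      · exact (fin_match h' h (ψ s).2 (ψ t).2 s.2 t.2 (fun N a b => (m s N b a).symm)
          (fun N a b => (m t N b a).symm) hc' hc h0').symm
    · exact fin_match h h' s.2 t.2 (ψ s).2 (ψ t).2 (fun N a b => m s N a b)
          (fun N a b => m t N a b) hc hc' h0

end SE

namespace SE

variable {W : Type} [Group W] {S S' : Set W}

lemma A_pair (h : SEv S) {T : Set W} (hT : T ⊆ S) (hfin : Finite (Subgroup.closure T)) {s t : W}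
    (hs : s ∈ T) (ht : t ∈ T) (hst : s * t ≠ t * s) : A T s = {s, t} := by
  obtain ⟨t0, _, hA, _⟩ := A_eq h hT hfin hs
  have : t ∈ A T s := ⟨ht, Or.inr hst⟩
  rw [hA] at this
  rcases this with e | e
  · exact absurd (by rw [e]) hst
  · rw [Set.mem_singleton_iff] at e
    rw [hA, e]

lemma factB' (h : SEv S) {s t : W} (hs : s ∈ S) (ht : t ∈ S) (hst : s ≠ t) {x y : W}
    (hx : x ∈ Subgroup.closure {s, t}) (hy : y ∈ Subgroup.closure {s, t}) (hx2 : x * x = 1)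
    (h1 : chi h s x = 1) (h2 : chi h t x = 1) : x * y = y * x := by
  obtain ⟨j, hj⟩ := factB h hs ht hst hx h1 h2
  have hs2 := sq h.1 hs
  have ht2 := sq h.1 ht
  have hinv : (s * t) ^ (-j) = (s * t) ^ j := by
    rw [zpow_neg, ← hj]; exact inv_eq_of_mul_eq_one_left hx2
  subst hj
  obtain ⟨i, rfl | rfl⟩ := dih hs2 ht2 hy
  · rw [← zpow_add, ← zpow_add, add_comm]
  · rw [← mul_assoc, rot_s hs2 ht2, hinv, mul_assoc, mul_assoc, ← zpow_add, ← zpow_add, add_comm]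

lemma core (h : SEv S) {T : Set W} (hT : T ⊆ S) (hfin : Finite (Subgroup.closure T)) {s t : W}
    (hs : s ∈ T) (ht : t ∈ T) (hst : s * t ≠ t * s) (N : Subgroup W) [N.Normal] {a b : W}
    (ha : a ∈ Subgroup.closure T) (hb : b ∈ Subgroup.closure T)
    (as : chi h s a = -1) (at' : chi h t a = 1) (bs : chi h s b = -1) (bt : chi h t b = 1)
    (hN : ∃ y ∈ N, y ∈ Subgroup.closure T ∧ y * y = 1 ∧ chi h t y = -1) :
    q h {s, t} ((a * b) ^ 4) ∈ N := by
  have hA := A_pair h hT hfin hs ht hst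
  have hne : s ≠ t := fun e => hst (by rw [e])
  have hs2 := sq h.1 (hT hs)
  have ht2 := sq h.1 (hT ht)
  obtain ⟨i, hi⟩ := factC h (hT hs) (hT ht) hne (q_range h {s, t} a)
    (by rw [chi_q h (by simp), chi_q h (by simp), as, at']; decide)
  obtain ⟨j, hj⟩ := factC h (hT hs) (hT ht) hne (q_range h {s, t} b)
    (by rw [chi_q h (by simp), chi_q h (by simp), bs, bt]; decide)
  have hab : q h {s, t} (a * b) = (s * t) ^ (-i + j) := by
    rw [map_mul, hi, hj, mul_assoc, ← mul_assoc _ s, rot_s hs2 ht2, mul_assoc s, ← mul_assoc s, hs2,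
      one_mul, zpow_add]
  obtain ⟨y, hyN, hyT, hy2, hyt⟩ := hN
  have hyc2 : q h {s, t} y * q h {s, t} y = 1 := by rw [← map_mul, hy2, map_one]
  have yt : chi h t (q h {s, t} y) = -1 := by rw [chi_q h (by simp), hyt]
  have ys : chi h s (q h {s, t} y) = 1 := (chi_or h s _).resolve_right fun c =>
    factA h (hT hs) (hT ht) hst (q_range h {s, t} y) hyc2 c yt
  obtain ⟨l, hl⟩ := factC h (hT hs) (hT ht) hne (q_range h {s, t} y) (by rw [ys, yt]; decide)
  set c := -i + j with hc
  have hz : y * (a * b) * y⁻¹ * (a * b)⁻¹ ∈ Subgroup.closure T :=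
    mul_mem (mul_mem (mul_mem hyT (mul_mem ha hb)) (inv_mem hyT)) (inv_mem (mul_mem ha hb))
  have hzN : y * (a * b) * y⁻¹ * (a * b)⁻¹ ∈ N := by
    have e : y * (a * b) * y⁻¹ * (a * b)⁻¹ = y * ((a * b) * y⁻¹ * (a * b)⁻¹) := by group
    rw [e]
    exact mul_mem hyN (Subgroup.Normal.conj_mem inferInstance _ (inv_mem hyN) _)
  have hqz : q h {s, t} (y * (a * b) * y⁻¹ * (a * b)⁻¹) = (s * t) ^ (-c + -c) := by
    rw [map_mul _ _ (a * b)⁻¹, map_mul _ _ y⁻¹, map_mul _ y, map_inv, map_inv, hab, hl,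
      refl_rot hs2 ht2, ← zpow_neg, ← zpow_add]
  set z := y * (a * b) * y⁻¹ * (a * b)⁻¹ with hzd
  clear_value z
  obtain ⟨v, hv1, hv2⟩ := dec h hT hfin hs hz
  rw [hA, hqz] at hv1
  rw [hA] at hv2
  have hsv : s * v = v * s := hv2 s (Subgroup.subset_closure (by simp))
  have hsz : s * z * s⁻¹ * z⁻¹ ∈ N :=
    mul_mem (Subgroup.Normal.conj_mem inferInstance _ hzN _) (inv_mem hzN)
  have e1 : s * z * s⁻¹ * z⁻¹ = (s * t) ^ (c * 4) := by
    rw [hv1]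
    calc s * ((s * t) ^ (-c + -c) * v) * s⁻¹ * ((s * t) ^ (-c + -c) * v)⁻¹
        = s * (s * t) ^ (-c + -c) * (s⁻¹ * (s * v) * s⁻¹) * v⁻¹ * ((s * t) ^ (-c + -c))⁻¹ := by
          group
      _ = s * (s * t) ^ (-c + -c) * (s⁻¹ * (v * s) * s⁻¹) * v⁻¹ * ((s * t) ^ (-c + -c))⁻¹ := by
          rw [hsv]
      _ = s * (s * t) ^ (-c + -c) * s⁻¹ * ((s * t) ^ (-c + -c))⁻¹ := by
          generalize (s * t) ^ (-c + -c) = r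
          group
      _ = (s * t) ^ (c * 4) := by
          rw [inv_eq_of_mul_eq_one_left hs2, rot_conj hs2 ht2, ← zpow_neg, ← zpow_add]
          congr 1; ring
  rw [e1] at hsz
  have e2 : q h {s, t} ((a * b) ^ 4) = (s * t) ^ (c * 4) := by
    rw [map_pow, hab, zpow_mul]; norm_cast
  rw [e2]
  exact hsz

theorem strong_even_transfer (h : SEv S) (hS' : IsCoxGenSet S') : IsStrongEvenSet S' := by
  classical
  intro s' hs' t' ht' hne
  by_contra hcon
  push Not at hcon
  obtain ⟨hm2, hm4⟩ := hcon
  have hs'2 := sq hS' hs'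
  have ht'2 := sq hS' ht'
  have hp4 : (s' * t') ^ 4 ≠ 1 := by
    intro h4
    have hd : orderOf (s' * t') ∣ 4 := orderOf_dvd_of_pow_eq_one h4
    have hle := Nat.le_of_dvd (by norm_num) hd
    have h1 : orderOf (s' * t') ≠ 1 := by
      intro h1
      rw [orderOf_eq_one_iff] at h1
      apply hne
      rw [eq_inv_of_mul_eq_one_left h1, inv_eq_of_mul_eq_one_left ht'2]
    generalize orderOf (s' * t') = m at *
    interval_cases m <;> omega
  have hm0 : orderOf (s' * t') ≠ 0 := fun e => hm4 (by rw [e]; exact dvd_zero 4)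
  obtain ⟨G, hG, hmf⟩ := exists_mf hS' _ (dih_finite hs'2 ht'2 hm0)
  obtain ⟨g, T, hT, hfin, hgG⟩ := mf_eq h.1 hmf
  obtain ⟨g', T', hT', hfin', hgG'⟩ := mf_eq hS' hmf
  let O : Set W := {u | (∀ x, chi h x u = chi h x s') ∨ (∀ x, chi h x u = chi h x t')}
  have hodd : ∀ u ∈ S', ∀ v ∈ S', u ∈ O → v ∉ O → Even (orderOf (u * v)) := by
    intro u hu v hv huO hvO
    by_contra hn
    rw [Nat.not_even_iff_odd] at hn
    apply hvO
    have hx : ∀ x, chi h x v = chi h x u := by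
      intro x
      have h1 := congrArg (chi h x) (pow_orderOf_eq_one (u * v))
      rw [map_pow, map_one, map_mul] at h1
      rcases chi_or h x u with e | e <;> rcases chi_or h x v with e' | e' <;> rw [e, e'] <;>
        rw [e, e'] at h1
      · rw [one_mul, hn.neg_one_pow] at h1; exact h1
      · rw [mul_one, hn.neg_one_pow] at h1; exact h1.symm
    rcases huO with c | c
    · exact Or.inl fun x => (hx x).trans (c x)
    · exact Or.inr fun x => (hx x).trans (c x)
  have hevp : ∀ {n : ℕ} {x : W}, Even n → x * x = 1 → x ^ n = 1 := by
    intro n x hn hx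
    obtain ⟨k, rfl⟩ := hn
    rw [← two_mul, pow_mul, pow_two, hx, one_pow]
  obtain ⟨r, hr⟩ := lift' hS' (fun u => if u ∈ O then u else 1) (by
    intro u hu
    have := sq hS' hu
    split_ifs <;> simp [this]) (by
    intro u hu v hv huv
    split_ifs with c1 c2 c2
    · exact pow_orderOf_eq_one _
    · rw [mul_one]; exact hevp (hodd u hu v hv c1 c2) (sq hS' hu)
    · rw [one_mul]
      have hmm : orderOf (u * v) = orderOf (v * u) := by
        have : v * u = (u * v)⁻¹ := by
          rw [mul_inv_rev, inv_eq hS' hu, inv_eq hS' hv]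
        rw [this, orderOf_inv]
      rw [hmm]
      exact hevp (hodd v hv u hu c2 c1) (sq hS' hv)
    · simp)
  have rs : r s' = s' := by rw [hr s' hs', if_pos (show s' ∈ O from Or.inl fun x => rfl)]
  have rt : r t' = t' := by rw [hr t' ht', if_pos (show t' ∈ O from Or.inr fun x => rfl)]
  have sG : s' ∈ G := hG (Subgroup.subset_closure (by simp))
  have tG : t' ∈ G := hG (Subgroup.subset_closure (by simp))
  have ha := (hgG s').1 sG
  have hb := (hgG t').1 tG
  have ha2 : (g⁻¹ * s' * g) * (g⁻¹ * s' * g) = 1 := by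
    have : (g⁻¹ * s' * g) * (g⁻¹ * s' * g) = g⁻¹ * (s' * s') * g := by group
    rw [this, hs'2]; group
  have hb2 : (g⁻¹ * t' * g) * (g⁻¹ * t' * g) = 1 := by
    have : (g⁻¹ * t' * g) * (g⁻¹ * t' * g) = g⁻¹ * (t' * t') * g := by group
    rw [this, ht'2]; group
  have hab : ∀ n : ℕ, ((g⁻¹ * s' * g) * (g⁻¹ * t' * g)) ^ n = g⁻¹ * (s' * t') ^ n * g := by
    intro n
    have := conj_pow (i := n) (a := g⁻¹) (b := s' * t')
    rw [inv_inv] at this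
    rw [← this]; congr 1; group
  -- the distinguished elements of the kernel
  have hker : ∀ t ∈ T, chi h t (g⁻¹ * s' * g) = 1 → chi h t (g⁻¹ * t' * g) = 1 →
      ∃ y ∈ r.ker, y ∈ Subgroup.closure T ∧ y * y = 1 ∧ chi h t y = -1 := by
    intro t ht c1 c2
    rw [chi_conj'] at c1 c2
    have htG : g * t * g⁻¹ ∈ G := by
      rw [hgG]
      have : g⁻¹ * (g * t * g⁻¹) * g = t := by group
      rw [this]; exact Subgroup.subset_closure ht
    have : ∃ u ∈ T', chi h t u = -1 := by
      by_contra hn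
      push Not at hn
      have hle : Subgroup.closure T' ≤ (chi h t).ker := by
        rw [Subgroup.closure_le]
        intro u hu
        exact (chi_or h t u).resolve_right (hn u hu)
      have := hle ((hgG' _).1 htG)
      rw [MonoidHom.mem_ker, chi_conj', chi_conj, chi_self h (hT ht)] at this
      exact absurd this (by decide)
    obtain ⟨u, hu, hut⟩ := this
    have huO : u ∉ O := by
      rintro (c | c)
      · have := c t
        rw [hut, c1] at this
        exact absurd this (by decide)
      · have := c t
        rw [hut, c2] at this
        exact absurd this (by decide)
    have ru : u ∈ r.ker := by
      rw [MonoidHom.mem_ker, hr u (hT' hu), if_neg huO]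
    have hu2 := sq hS' (hT' hu)
    refine ⟨g⁻¹ * (g' * u * g'⁻¹) * g, ?_, ?_, ?_, ?_⟩
    · have h1 := Subgroup.Normal.conj_mem (inferInstance : r.ker.Normal) u ru (g⁻¹ * g')
      have e : g⁻¹ * g' * u * (g⁻¹ * g')⁻¹ = g⁻¹ * (g' * u * g'⁻¹) * g := by group
      rwa [e] at h1
    · rw [← hgG, hgG']
      have : g'⁻¹ * (g' * u * g'⁻¹) * g' = u := by group
      rw [this]; exact Subgroup.subset_closure hu
    · have : g⁻¹ * (g' * u * g'⁻¹) * g * (g⁻¹ * (g' * u * g'⁻¹) * g) =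
        g⁻¹ * g' * (u * u) * g'⁻¹ * g := by group
      rw [this, hu2]; group
    · rw [chi_conj', chi_conj, hut]
  have main : ((g⁻¹ * s' * g) * (g⁻¹ * t' * g)) ^ 4 ∈ r.ker := by
    have habn := hab (orderOf (s' * t'))
    rw [pow_orderOf_eq_one, mul_one, inv_mul_cancel] at habn
    generalize g⁻¹ * s' * g = a at *
    generalize g⁻¹ * t' * g = b at *
    refine loc h hT hfin r.ker (pow_mem (mul_mem ha hb) 4) ?_
    intro s hs
    obtain ⟨t, ht, hA, hts⟩ := A_eq h hT hfin hs
    rw [hA]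
    have hx2 : q h {s, t} a * q h {s, t} a = 1 := by rw [← map_mul, ha2, map_one]
    have hy2 : q h {s, t} b * q h {s, t} b = 1 := by rw [← map_mul, hb2, map_one]
    have hx := q_range h {s, t} a
    have hy := q_range h {s, t} b
    have hcomm : q h {s, t} a * q h {s, t} b = q h {s, t} b * q h {s, t} a →
        q h {s, t} ((a * b) ^ 4) ∈ r.ker := by
      intro hc
      have h2 := two_of_comm hx2 hy2 hc
      rw [map_pow, map_mul, show 4 = 2 * 2 from rfl, pow_mul, h2, one_pow]
      exact one_mem _
    rcases hts with rfl | hst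
    · apply hcomm
      refine clo_comm ?_ hx hy
      intro a ha b hb
      simp only [Set.mem_insert_iff, Set.mem_singleton_iff, or_self] at ha hb
      rw [ha, hb]
    · have hne : s ≠ t := fun e => hst (by rw [e])
      have xs : chi h s (q h {s, t} a) = chi h s a := chi_q h (by simp) _
      have xt : chi h t (q h {s, t} a) = chi h t a := chi_q h (by simp) _
      have ys : chi h s (q h {s, t} b) = chi h s b := chi_q h (by simp) _
      have yt : chi h t (q h {s, t} b) = chi h t b := chi_q h (by simp) _
      have hodd2 : chi h s (a * b) = -1 → chi h t (a * b) = -1 → False := by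
        intro d1 d2
        have hz := q_range h {s, t} (a * b)
        have hzs : chi h s (q h {s, t} (a * b)) = -1 := by rw [chi_q h (by simp), d1]
        have hzt : chi h t (q h {s, t} (a * b)) = -1 := by rw [chi_q h (by simp), d2]
        obtain ⟨j, hj | hj⟩ := dih (sq h.1 (hT hs)) (sq h.1 (hT ht)) hz
        · have hjo : ¬ Even j := by
            intro he
            rw [hj, (chi_rot h (hT hs) (hT ht) hne j).1, m1_even he] at hzs
            exact absurd hzs (by decide)
          have hq := congrArg (q h {s, t}) habn
          rw [map_pow, map_one, hj, ← zpow_natCast, ← zpow_mul] at hq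
          have hd := orderOf_dvd_iff_zpow_eq_one.2 hq
          have h4 : (4 : ℤ) ∣ j * (orderOf (s' * t') : ℤ) :=
            (Int.natCast_dvd_natCast.2 (four_dvd h (hT hs) (hT ht) hst)).trans hd
          have hcop : IsCoprime (4 : ℤ) j := by
            rw [Int.not_even_iff_odd] at hjo
            have : IsCoprime (2 : ℤ) j := by
              obtain ⟨k, hk⟩ := hjo
              exact ⟨-k, 1, by rw [hk]; ring⟩
            have := IsCoprime.pow_left (m := 2) this
            norm_num at this
            exact this
          have := hcop.dvd_of_dvd_mul_left h4
          exact hm4 (by exact_mod_cast this)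
        · rw [hj, (chi_rot h (hT hs) (hT ht) hne j).2.2.1] at hzs
          rw [hj, (chi_rot h (hT hs) (hT ht) hne j).2.2.2] at hzt
          rw [hzt] at hzs
          exact absurd hzs (by decide)
      rcases chi_or h s a with a1 | a1 <;> rcases chi_or h t a with a2 | a2
      · exact hcomm (factB' h (hT hs) (hT ht) hne hx hy hx2 (xs.trans a1) (xt.trans a2))
      · rcases chi_or h s b with b1 | b1 <;> rcases chi_or h t b with b2 | b2
        · exact hcomm (factB' h (hT hs) (hT ht) hne hy hx hy2 (ys.trans b1) (yt.trans b2)).symm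
        · rw [Set.pair_comm]
          exact core h hT hfin ht hs (Ne.symm hst) r.ker ha hb a2 a1 b2 b1 (hker s hs a1 b1)
        · exact (hodd2 (by rw [map_mul, a1, b1]; decide) (by rw [map_mul, a2, b2]; decide)).elim
        · exact (factA h (hT hs) (hT ht) hst hy hy2 (ys.trans b1) (yt.trans b2)).elim
      · rcases chi_or h s b with b1 | b1 <;> rcases chi_or h t b with b2 | b2
        · exact hcomm (factB' h (hT hs) (hT ht) hne hy hx hy2 (ys.trans b1) (yt.trans b2)).symm
        · exact (hodd2 (by rw [map_mul, a1, b1]; decide) (by rw [map_mul, a2, b2]; decide)).elim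
        · exact core h hT hfin hs ht hst r.ker ha hb a1 a2 b1 b2 (hker t ht a2 b2)
        · exact (factA h (hT hs) (hT ht) hst hy hy2 (ys.trans b1) (yt.trans b2)).elim
      · exact (factA h (hT hs) (hT ht) hst hx hx2 (xs.trans a1) (xt.trans a2)).elim
  rw [hab, MonoidHom.mem_ker, map_mul, map_mul, map_pow, map_mul, rs, rt, map_inv] at main
  apply hp4
  have := eq_mul_inv_of_mul_eq main
  rw [one_mul, inv_mul_eq_iff_eq_mul, mul_inv_cancel] at this
  exact this

end SE

/-- Radcliffe: a strong even Coxeter system gives a rigid Coxeter group. -/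
theorem strong_even_rigid {W : Type} [Group W] (S : Set W) (hS : IsCoxGenSet S)
    (hse : IsStrongEvenSet S) :
    ∀ S' : Set W, IsCoxGenSet S' →
      ∃ ψ : S ≃ S', ∀ s t : S,
        orderOf ((s : W) * (t : W)) = orderOf ((ψ s : W) * (ψ t : W)) := by
  intro S' hS'
  exact SE.rigid_both ⟨hS, hse⟩ ⟨hS', SE.strong_even_transfer ⟨hS, hse⟩ hS'⟩
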